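/- Let k and ℓ be number fields, let a, b ∈ k and c, d ∈ ℓ be nonzero, set K = k_{a,b} and L = ℓ_{c,d}, and let α be a Witt equivalence from K to L. Define V_k = { r ∈ kˣ : the principal fractional ideal of the ring of integers of k generated by r is the square of a fractional ideal }, and similarly V_ℓ. Then for every r ∈ V_k there exists s ∈ V_ℓ such that α(square class of r in Kˣ/Kˣ²) = (square class of s in Lˣ/Lˣ²), and conversely for every s ∈ V_ℓ there exists r ∈ V_k with the same property. -/

import Mathlib

open MvPolynomial

noncomputable section

/-- The defining polynomial `a·x² + b·y² − 1` of the affine conic. -/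
def conicPoly (k : Type*) [Field k] (a b : k) : MvPolynomial (Fin 2) k :=
  C a * X 0 ^ 2 + C b * X 1 ^ 2 - 1

/-- The coordinate ring `k[x,y]/(a·x² + b·y² − 1)` of the affine conic. -/
abbrev ConicRing (k : Type*) [Field k] (a b : k) : Type _ :=
  MvPolynomial (Fin 2) k ⧸ Ideal.span {conicPoly k a b}

/-- `K` (together with the embedding `ι : k →+* K`) is a model of the function field
`k_{a,b}`, i.e. the quotient field of `k[x,y]/(a·x² + b·y² − 1)`. -/
def IsConicFunctionField (k : Type*) [Field k] (a b : k)
    (K : Type*) [Field K] (ι : k →+* K) : Prop :=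
  ∃ f : ConicRing k a b →+* K,
    Function.Injective f ∧
    f.comp (algebraMap k (ConicRing k a b)) = ι ∧
    ∀ z : K, ∃ p q : ConicRing k a b, f q ≠ 0 ∧ z = f p / f q

/-- The subgroup of squares in `Kˣ`. -/
def sqSubgroup (K : Type*) [Field K] : Subgroup Kˣ :=
  MonoidHom.range (powMonoidHom 2 : Kˣ →* Kˣ)

/-- The square class group `Kˣ/Kˣ²`. -/
abbrev SqClass (K : Type*) [Field K] := Kˣ ⧸ sqSubgroup K

/-- The square class of a unit. -/
def sqCl {K : Type*} [Field K] (u : Kˣ) : SqClass K := QuotientGroup.mk u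

/-- `α : Kˣ/Kˣ² → Lˣ/Lˣ²` is a Witt equivalence: it sends `-1` to `-1` and preserves
binary value sets. -/
structure IsWittEquiv {K L : Type*} [Field K] [Field L]
    (α : SqClass K ≃* SqClass L) : Prop where
  map_neg_one : α (sqCl (-1)) = sqCl (-1)
  represents : ∀ (a b c : Kˣ) (a' b' c' : Lˣ),
    α (sqCl a) = sqCl a' → α (sqCl b) = sqCl b' → α (sqCl c) = sqCl c' →
    ((∃ x y : K, (c : K) = (a : K) * x ^ 2 + (b : K) * y ^ 2) ↔
      (∃ x y : L, (c' : L) = (a' : L) * x ^ 2 + (b' : L) * y ^ 2))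

/-- Two fields are Witt equivalent if there is a Witt equivalence between them. -/
def WittEquivalent (K L : Type*) [Field K] [Field L] : Prop :=
  ∃ α : SqClass K ≃* SqClass L, IsWittEquiv α

/-- An ordering of a field `F`. -/
structure IsOrdering {F : Type*} [Field F] (P : Set F) : Prop where
  add_mem : ∀ x ∈ P, ∀ y ∈ P, x + y ∈ P
  mul_mem : ∀ x ∈ P, ∀ y ∈ P, x * y ∈ P
  total : ∀ x : F, x ∈ P ∨ -x ∈ P
  antisymm : ∀ x : F, x ∈ P → -x ∈ P → x = 0


/-- A pair `T ⊆ H` of subgroups of `Kˣ` (as subsets of `K`) such that every `x ∉ H` is `T`-rigid. -/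
structure IsRigidPair {K : Type*} [Field K] (T H : Set K) : Prop where
  zero_notMem : (0 : K) ∉ H
  subset : T ⊆ H
  neg_one_mem : (-1 : K) ∈ T
  mul_mem : ∀ x ∈ T, ∀ y ∈ T, x * y ∈ T
  inv_mem : ∀ x ∈ T, x⁻¹ ∈ T
  mul_mem' : ∀ x ∈ H, ∀ y ∈ H, x * y ∈ H
  inv_mem' : ∀ x ∈ H, x⁻¹ ∈ H
  rigid : ∀ x, x ≠ 0 → x ∉ H → 1 + x ∈ T ∨ (1 + x) / x ∈ T

namespace IsRigidPair

variable {K : Type*} [Field K] {T H : Set K}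

/-- The non-units of the valuation ring attached to a rigid pair. -/
def Neg (T H : Set K) (x : K) : Prop := x ≠ 0 ∧ x ∉ H ∧ 1 + x ∈ T

/-- The part inside `H` of the valuation ring attached to a rigid pair. -/
def Pos (T H : Set K) (x : K) : Prop := x ∈ H ∧ ∀ z, Neg T H z → Neg T H (x * z)

variable (hP : IsRigidPair T H)
include hP

lemma ne_zero {x : K} (h : x ∈ H) : x ≠ 0 := fun h0 => hP.zero_notMem (h0 ▸ h)

lemma one_mem : (1 : K) ∈ T := by simpa using hP.mul_mem _ hP.neg_one_mem _ hP.neg_one_mem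

lemma neg_mem {x : K} (h : x ∈ T) : -x ∈ T := by simpa using hP.mul_mem _ hP.neg_one_mem _ h

lemma div_mem {x y : K} (hx : x ∈ T) (hy : y ∈ T) : x / y ∈ T := by
  rw [div_eq_mul_inv]; exact hP.mul_mem _ hx _ (hP.inv_mem _ hy)

lemma div_mem' {x y : K} (hx : x ∈ H) (hy : y ∈ H) : x / y ∈ H := by
  rw [div_eq_mul_inv]; exact hP.mul_mem' _ hx _ (hP.inv_mem' _ hy)

lemma ne_of_div_mem {u v : K} (h : u / v ∈ H) : u ≠ 0 ∧ v ≠ 0 := by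
  have := hP.ne_zero h
  exact ⟨fun h0 => this (by simp [h0]), fun h0 => this (by simp [h0])⟩

lemma swap {u v : K} (h : u / v ∈ T) : v / u ∈ T := by
  have := hP.inv_mem _ h; rwa [inv_div] at this

lemma trans {u v w : K} (h : u / v ∈ T) (h' : v / w ∈ T) : u / w ∈ T := by
  have hv := (hP.ne_of_div_mem (hP.subset h)).2
  have := hP.mul_mem _ h _ h'
  rwa [div_mul_div_cancel₀ hv] at this

lemma comm_trans {u v w : K} (h : u / v ∈ T) (h' : u / w ∈ T) : v / w ∈ T :=
  hP.trans (hP.swap h) h'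

lemma add_mem {y z y' z' : K} (hy : y' / y ∈ T) (hz : z' / z ∈ T) (hn : z / y ∉ H) :
    (y' + z') / y ∈ T ∨ (y' + z') / z ∈ T := by
  obtain ⟨hy'0, hy0⟩ := hP.ne_of_div_mem (hP.subset hy)
  obtain ⟨hz'0, hz0⟩ := hP.ne_of_div_mem (hP.subset hz)
  have h1 : z' / y' ∉ H := fun h => hn (by
    have := hP.mul_mem' _ (hP.mul_mem' _ h _ (hP.subset hy)) _ (hP.inv_mem' _ (hP.subset hz))
    convert this using 1; field_simp)
  rcases hP.rigid _ (div_ne_zero hz'0 hy'0) h1 with h | h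
  · left
    have := hP.mul_mem _ h _ hy
    convert this using 1; field_simp
  · right
    have := hP.mul_mem _ h _ hz
    convert this using 1; field_simp

lemma neg_notMem {x : K} (h : x ∉ H) : -x ∉ H := fun h' => h (by
  have := hP.mul_mem' _ (hP.subset hP.neg_one_mem) _ h'; simpa using this)

lemma mul_notMem {x y : K} (hx : x ∈ H) (h : y ∉ H) : x * y ∉ H := fun h' => h (by
  have := hP.div_mem' h' hx
  rwa [mul_div_cancel_left₀ _ (hP.ne_zero hx)] at this)

lemma inv_notMem {x : K} (h : x ∉ H) : x⁻¹ ∉ H := fun h' => h (by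
  simpa using hP.inv_mem' _ h')

/-- Existence of an element of `H` that is not `T`-rigid, in the form `1 + e ∈ H ∖ (T ∪ eT)`. -/
def Good (T H : Set K) (e : K) : Prop := e ∈ H ∧ 1 + e ∈ H ∧ 1 + e ∉ T ∧ (1 + e) / e ∉ T

omit hP in
/-- `x ∉ H` whose two associates `x` and `-x` behave differently. -/
def Bad (T H : Set K) (x : K) : Prop := x ≠ 0 ∧ x ∉ H ∧ 1 + x ∈ T ∧ (1 - x) / x ∈ T

lemma bad_inv {x : K} (h : Bad T H x) : Bad T H (-x⁻¹) := by
  obtain ⟨h0, h1, h2, h3⟩ := h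
  refine ⟨by simpa using h0, hP.neg_notMem (hP.inv_notMem h1), ?_, ?_⟩
  · have := hP.neg_mem h3
    have e : -((1 - x) / x) = 1 + -x⁻¹ := by field_simp; ring
    rwa [e] at this
  · have := hP.neg_mem h2
    have e : -(1 + x) = (1 - -x⁻¹) / -x⁻¹ := by field_simp; ring
    rwa [e] at this

lemma bad_aux {x e : K} (h : Bad T H x) (he : Good T H e) : (1 + e * x) / (e * x) ∈ T := by
  obtain ⟨h0, h1, h2, h3⟩ := h
  obtain ⟨k1, k2, k3, k4⟩ := he
  have e0 := hP.ne_zero k1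
  have hex := hP.mul_notMem k1 h1
  rcases hP.rigid _ (mul_ne_zero e0 h0) hex with h | h
  · exfalso
    have hz : (e * (1 - x)) / (e * x) ∈ T := by
      rwa [mul_div_mul_left _ _ e0]
    have := hP.add_mem (y := 1) (y' := 1 + e * x) (by simpa using h) hz (by simpa using hex)
    have e1 : 1 + e * x + e * (1 - x) = 1 + e := by ring
    rw [e1, div_one] at this
    rcases this with h | h
    · exact k3 h
    · refine hex ?_
      have := hP.div_mem' k2 (hP.subset h)
      rwa [div_div_cancel₀ (hP.ne_zero k2)] at this
  · exact h

lemma good_inv {e : K} (he : Good T H e) : Good T H e⁻¹ := by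
  obtain ⟨k1, k2, k3, k4⟩ := he
  have e0 := hP.ne_zero k1
  have e1 : 1 + e⁻¹ = (1 + e) / e := by field_simp; ring
  have e2 : (1 + e⁻¹) / e⁻¹ = 1 + e := by field_simp; ring
  refine ⟨hP.inv_mem' _ k1, ?_, ?_, ?_⟩
  · rw [e1]; exact hP.div_mem' k2 k1
  · rwa [e1]
  · rwa [e2]

lemma good_neg {e : K} (he : Good T H e) (ht : e ∉ T) : Good T H (-(1 + e)) := by
  obtain ⟨k1, k2, k3, k4⟩ := he
  have e0 := hP.ne_zero k1
  have g0 := hP.ne_zero k2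
  have e1 : 1 + -(1 + e) = -e := by ring
  have hneg : ∀ x ∈ H, -x ∈ H := fun x hx => by
    simpa using hP.mul_mem' _ (hP.subset hP.neg_one_mem) _ hx
  refine ⟨hneg _ k2, ?_, ?_, ?_⟩
  · rw [e1]; exact hneg _ k1
  · rw [e1]; intro h; exact ht (by simpa using hP.neg_mem h)
  · rw [e1, neg_div_neg_eq]; intro h; exact k4 (hP.swap h)

/-- `-e / (1 + e)` -/
lemma good_div {e : K} (he : Good T H e) (ht : e ∉ T) : Good T H (-(e / (1 + e))) := by
  have := hP.good_inv (hP.good_neg (hP.good_inv he) (fun h => ht (by simpa using hP.inv_mem _ h)))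
  convert this using 1
  have e0 := hP.ne_zero he.1
  have g0 := hP.ne_zero he.2.1
  have : e + 1 ≠ 0 := by rwa [add_comm]
  field_simp
  rw [add_comm]

lemma bad_mul {x e : K} (h : Bad T H x) (he : Good T H e) : Bad T H (-(e * x)) := by
  have e0 := hP.ne_zero he.1
  have x0 := h.1
  refine ⟨neg_ne_zero.2 (mul_ne_zero e0 h.1), hP.neg_notMem (hP.mul_notMem he.1 h.2.1), ?_, ?_⟩
  · have := hP.bad_aux (hP.bad_inv h) (hP.good_inv he)
    convert this using 1
    field_simp; ring
  · have := hP.neg_mem (hP.bad_aux h he)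
    convert this using 1
    field_simp; ring

lemma not_bad {x e : K} (he : Good T H e) (ht : e ∉ T) : ¬ Bad T H x := by
  intro h
  have h1 := hP.bad_mul h he
  have h2 := hP.bad_mul h (hP.good_neg he ht)
  have h3 := hP.bad_mul h2 (hP.good_div he ht)
  have g0 := hP.ne_zero he.2.1
  have e3 : -(-(e / (1 + e)) * -(-(1 + e) * x)) = e * x := by field_simp
  rw [e3] at h3
  obtain ⟨-, -, -, a⟩ := h1
  obtain ⟨b0, b1, b, -⟩ := h3
  refine b1 (hP.subset ?_)
  have a' : (1 + e * x) / (e * x) ∈ T := by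
    have := hP.neg_mem a
    convert this using 1
    rw [div_neg, neg_neg]; congr 1; ring
  have := hP.div_mem b a'
  rwa [div_div_cancel₀ (fun h0 => by rw [h0] at b; exact hP.zero_notMem (hP.subset b))] at this

variable {h : K} (hg : Good T H h) (ht : h ∉ T)
include hg ht

lemma neg_sub {x : K} (hx : Neg T H x) : 1 - x ∈ T := by
  rcases hP.rigid _ (neg_ne_zero.2 hx.1) (hP.neg_notMem hx.2.1) with k | k
  · simpa [sub_eq_add_neg] using k
  · refine absurd ⟨hx.1, hx.2.1, hx.2.2, ?_⟩ (hP.not_bad (x := x) hg ht)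
    have := hP.neg_mem k
    convert this using 1
    rw [div_neg, neg_neg, sub_eq_add_neg]

lemma neg_neg {x : K} (hx : Neg T H x) : Neg T H (-x) :=
  ⟨neg_ne_zero.2 hx.1, hP.neg_notMem hx.2.1, by simpa [sub_eq_add_neg] using hP.neg_sub hg ht hx⟩

omit hg ht in
lemma neg_or {x : K} (h0 : x ≠ 0) (hx : x ∉ H) : Neg T H x ∨ Neg T H x⁻¹ := by
  rcases hP.rigid _ h0 hx with k | k
  · exact Or.inl ⟨h0, hx, k⟩
  · refine Or.inr ⟨inv_ne_zero h0, hP.inv_notMem hx, ?_⟩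
    convert k using 1; field_simp; ring

omit hg ht in
lemma neg_not {x : K} (hx : Neg T H x) (hx' : Neg T H x⁻¹) : False := by
  refine hx.2.1 (hP.subset ?_)
  have := hP.div_mem hx.2.2 hx'.2.2
  have h0 := hx.1
  have e : (1 + x) / (1 + x⁻¹) = x := by
    have : 1 + x ≠ 0 := hP.ne_zero (hP.subset hx.2.2)
    have e1 : 1 + x⁻¹ = (1 + x) / x := by field_simp; ring
    rw [e1, div_div_cancel₀ this]
  rwa [e] at this

omit hg ht in
lemma not_neg {x : K} (h0 : x ≠ 0) (hx : x ∉ H) (hn : ¬ Neg T H x) : (1 + x) / x ∈ T :=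
  (hP.rigid _ h0 hx).resolve_left fun h => hn ⟨h0, hx, h⟩

lemma pos_good {e : K} (he : Good T H e) : Pos T H e := by
  refine ⟨he.1, fun x hx => ?_⟩
  have e0 := hP.ne_zero he.1
  have hex := hP.mul_notMem he.1 hx.2.1
  by_contra hn
  have k := hP.not_neg (mul_ne_zero e0 hx.1) hex hn
  have k2 : (e * (1 - x)) / e ∈ T := by
    rw [mul_div_cancel_left₀ _ e0]; exact hP.neg_sub hg ht hx
  have := hP.add_mem k2 k (by rw [mul_div_cancel_left₀ _ e0]; exact hx.2.1)
  have e1 : e * (1 - x) + (1 + e * x) = 1 + e := by ring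
  rw [e1] at this
  rcases this with k | k
  · exact he.2.2.2 k
  · refine hex ?_
    have := hP.div_mem' he.2.1 (hP.subset k)
    rwa [div_div_cancel₀ (hP.ne_zero he.2.1)] at this

lemma neg_mul_aux {x y : K} (hx : Neg T H x) (hy : Neg T H y) :
    1 + x * y ∈ T ∨ (1 + x * y) / x ∈ T := by
  have k2 : (-(x * (1 - y))) / x ∈ T := by
    rw [neg_div, mul_div_cancel_left₀ _ hx.1]; exact hP.neg_mem (hP.neg_sub hg ht hy)
  have := hP.add_mem (y := 1) (y' := 1 + x) (by simpa using hx.2.2) k2 (by simpa using hx.2.1)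
  have e1 : 1 + x + -(x * (1 - y)) = 1 + x * y := by ring
  rwa [e1, div_one] at this

lemma neg_mul {x y : K} (hx : Neg T H x) (hy : Neg T H y) (hxy : x * y ∉ H) :
    Neg T H (x * y) := by
  by_contra hn
  have xy0 := mul_ne_zero hx.1 hy.1
  have k := hP.not_neg xy0 hxy hn
  rcases hP.neg_mul_aux hg ht hx hy with h | h
  · exact hn ⟨xy0, hxy, h⟩
  · have := hP.comm_trans h k
    have e : x / (x * y) = y⁻¹ := by have := hx.1; have := hy.1; field_simp
    rw [e] at this
    exact hy.2.1 (hP.subset (by simpa using hP.inv_mem _ this))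

lemma neg_mul_mul {x y z : K} (hx : Neg T H x) (hy : Neg T H y) (hz : Neg T H z)
    (hxy : x * y ∈ H) (hn : ¬ Neg T H (x * y * z)) : x * y ∈ T := by
  have e0 := hP.ne_zero hxy
  have hez := hP.mul_notMem hxy hz.2.1
  have k := hP.not_neg (mul_ne_zero e0 hz.1) hez hn
  have k2 : (x * y * (1 - z)) / (x * y) ∈ T := by
    rw [mul_div_cancel_left₀ _ e0]; exact hP.neg_sub hg ht hz
  have := hP.add_mem k2 k (by rw [mul_div_cancel_left₀ _ e0]; exact hz.2.1)
  have e1 : x * y * (1 - z) + (1 + x * y * z) = 1 + x * y := by ring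
  rw [e1] at this
  rcases hP.neg_mul_aux hg ht hx hy with h | h
  · have hg := hP.ne_zero (hP.subset h)
    rcases this with k | k
    · have := hP.div_mem h k
      rwa [div_div_cancel₀ hg] at this
    · refine absurd (hP.subset ?_) hez
      have := hP.div_mem h k
      rwa [div_div_cancel₀ hg] at this
  · have h' : (-(1 + x * y)) / x ∈ T := by rw [neg_div]; exact hP.neg_mem h
    have := hP.add_mem (y := 1) (y' := 1) (by simpa using hP.one_mem) h' (by simpa using hx.2.1)
    have e1 : 1 + -(1 + x * y) = -(x * y) := by ring
    rw [e1, div_one] at this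
    rcases this with k | k
    · simpa using hP.neg_mem k
    · exfalso
      refine hx.2.1 ?_
      have k' := hP.neg_mem k
      rw [neg_div, _root_.neg_neg] at k'
      have := hP.div_mem' hxy (hP.subset k')
      rwa [div_div_cancel₀ e0] at this

lemma pos_h : Pos T H h := hP.pos_good hg ht hg
lemma pos_hinv : Pos T H h⁻¹ := hP.pos_good hg ht (hP.good_inv hg)

lemma pos_mul_neg {x y : K} (hx : Neg T H x) (hy : Neg T H y) (hxy : x * y ∈ H) :
    Pos T H (x * y) := by
  refine ⟨hxy, fun z hz => ?_⟩
  by_contra hn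
  have k1 := hP.neg_mul_mul hg ht hx hy hz hxy hn
  have h0 := hP.ne_zero hg.1
  have k2 := hP.neg_mul_mul hg ht ((hP.pos_h hg ht).2 x hx) hy hz
    (by rw [mul_assoc]; exact hP.mul_mem' _ hg.1 _ hxy)
    (fun h' => hn (by
      have := (hP.pos_hinv hg ht).2 _ h'
      convert this using 1; field_simp))
  refine ht ?_
  have := hP.div_mem k2 k1
  rwa [mul_assoc, mul_div_cancel_right₀ _ (hP.ne_zero hxy)] at this

omit hg ht in
lemma pos_mul {x y : K} (hx : Pos T H x) (hy : Pos T H y) : Pos T H (x * y) :=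
  ⟨hP.mul_mem' _ hx.1 _ hy.1, fun z hz => by rw [mul_assoc]; exact hx.2 _ (hy.2 _ hz)⟩

omit hP hg ht in
/-- Membership in the valuation ring attached to a rigid pair. -/
def Mem (T H : Set K) (x : K) : Prop := x = 0 ∨ Neg T H x ∨ Pos T H x

lemma mem_mul {x y : K} (hx : Mem T H x) (hy : Mem T H y) : Mem T H (x * y) := by
  rcases hx with rfl | hx | hx
  · left; simp
  · rcases hy with rfl | hy | hy
    · left; simp
    · by_cases hxy : x * y ∈ H
      · exact Or.inr (Or.inr (hP.pos_mul_neg hg ht hx hy hxy))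
      · exact Or.inr (Or.inl (hP.neg_mul hg ht hx hy hxy))
    · right; left; rw [mul_comm]; exact hy.2 _ hx
  · rcases hy with rfl | hy | hy
    · left; simp
    · exact Or.inr (Or.inl (hx.2 _ hy))
    · exact Or.inr (Or.inr (hP.pos_mul hx hy))

lemma mem_or_inv (x : K) : Mem T H x ∨ Mem T H x⁻¹ := by
  by_cases h0 : x = 0
  · exact Or.inl (Or.inl h0)
  by_cases hx : x ∈ H
  swap
  · rcases hP.neg_or h0 hx with h | h
    · exact Or.inl (Or.inr (Or.inl h))
    · exact Or.inr (Or.inr (Or.inl h))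
  by_contra! hn
  have h1 : ¬ Pos T H x := fun h => hn.1 (Or.inr (Or.inr h))
  have h2 : ¬ Pos T H x⁻¹ := fun h => hn.2 (Or.inr (Or.inr h))
  simp only [Pos, hx, hP.inv_mem' _ hx, true_and, not_forall] at h1 h2
  obtain ⟨a, ha, hxa⟩ := h1
  obtain ⟨b, hb, hxb⟩ := h2
  have ha' := (hP.neg_or (mul_ne_zero h0 ha.1) (hP.mul_notMem hx ha.2.1)).resolve_left hxa
  have hb' := (hP.neg_or (mul_ne_zero (inv_ne_zero h0) hb.1)
    (hP.mul_notMem (hP.inv_mem' _ hx) hb.2.1)).resolve_left hxb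
  have a0 := ha.1
  have b0 := hb.1
  have e : (x * a)⁻¹ * (x⁻¹ * b)⁻¹ = (a * b)⁻¹ := by field_simp
  by_cases hab : a * b ∈ H
  · have := hP.pos_mul_neg hg ht ha' hb' (by rw [e]; exact hP.inv_mem' _ hab)
    have := this.2 _ ha
    rw [e] at this
    have e : (a * b)⁻¹ * a = b⁻¹ := by field_simp
    rw [e] at this
    exact hP.neg_not hb this
  · have := hP.neg_mul hg ht ha' hb' (by rw [e]; exact hP.inv_notMem hab)
    rw [e] at this
    exact hP.neg_not (hP.neg_mul hg ht ha hb hab) this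

omit hg ht in
lemma one_add_neg_aux {a z : K} (ha : Neg T H a) (hz : Neg T H z)
    (hn : ¬ Neg T H ((1 + a) * z)) : a / z ∈ T := by
  have u0 := hP.ne_zero (hP.subset ha.2.2)
  have z0 := hz.1
  have k := hP.not_neg (mul_ne_zero u0 z0) (hP.mul_notMem (hP.subset ha.2.2) hz.2.1) hn
  have k1 : ((1 + a)⁻¹ + z) / z ∈ T := by
    convert k using 1
    field_simp
  have k2 : (-(a * (1 + a)⁻¹)) / a ∈ T := by
    rw [neg_div, mul_div_cancel_left₀ _ ha.1]
    exact hP.neg_mem (hP.inv_mem _ ha.2.2)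
  have := hP.add_mem (y := 1) (y' := 1 + z) (by simpa using hz.2.2) k2 (by simpa using ha.2.1)
  have e : 1 + z + -(a * (1 + a)⁻¹) = (1 + a)⁻¹ + z := by field_simp; ring
  rw [e] at this
  rcases this with h | h
  · have := hP.comm_trans h k1
    rw [one_div] at this
    exact absurd (by simpa using hP.inv_mem _ this) (fun h => hz.2.1 (hP.subset h))
  · exact hP.comm_trans h k1

lemma one_add_neg {a : K} (ha : Neg T H a) : Pos T H (1 + a) := by
  refine ⟨hP.subset ha.2.2, fun z hz => ?_⟩
  by_contra hn
  have k1 := hP.one_add_neg_aux ha hz hn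
  have h0 := hP.ne_zero hg.1
  have k2 := hP.one_add_neg_aux ha ((hP.pos_h hg ht).2 z hz) (fun h' => hn (by
    have := (hP.pos_hinv hg ht).2 _ h'
    convert this using 1; field_simp))
  refine ht ?_
  have := hP.div_mem k1 k2
  convert this using 1
  have := ha.1
  have := hz.1
  field_simp

lemma one_add_pos_notMem {a : K} (ha : Pos T H a) (h0 : 1 + a ≠ 0) (hn : 1 + a ∉ H) :
    Neg T H (1 + a) := by
  refine (hP.neg_or h0 hn).resolve_right fun hb => ?_
  have k := hP.neg_sub hg ht (ha.2 _ hb)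
  have e : 1 - a * (1 + a)⁻¹ = (1 + a)⁻¹ := by field_simp; ring
  rw [e] at k
  exact hb.2.1 (hP.subset k)

omit hg ht in
lemma one_add_pos_aux {a z : K} (ha : Pos T H a) (h1 : 1 + a ∈ H) (hz : Neg T H z)
    (hn : ¬ Neg T H ((1 + a) * z)) : (a * z) / ((1 + a) * z) ∈ T := by
  have u0 := hP.ne_zero h1
  have hnH := hP.mul_notMem h1 hz.2.1
  have k := hP.not_neg (mul_ne_zero u0 hz.1) hnH hn
  have haz := ha.2 _ hz
  have := hP.add_mem (y := 1) (y' := 1 + z) (z := a * z) (z' := a * z) (by simpa using hz.2.2)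
    (by rw [div_self haz.1]; exact hP.one_mem) (by simpa using haz.2.1)
  have e : 1 + z + a * z = 1 + (1 + a) * z := by ring
  rw [e, div_one] at this
  rcases this with h | h
  · refine absurd (hP.subset ?_) hnH
    have := hP.div_mem h k
    rwa [div_div_cancel₀ (hP.ne_zero (hP.subset h))] at this
  · exact hP.comm_trans h k

lemma mem_one_add_of_notMem {a : K} (ha : Pos T H a) (haT : a ∉ T) : Mem T H (1 + a) := by
  by_cases h0 : 1 + a = 0
  · exact Or.inl h0
  by_cases h1 : 1 + a ∈ H
  swap
  · exact Or.inr (Or.inl (hP.one_add_pos_notMem hg ht ha h0 h1))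
  refine Or.inr (Or.inr ⟨h1, fun z hz => ?_⟩)
  by_contra hn
  have k1 := hP.one_add_pos_aux ha h1 hz hn
  have k := hP.not_neg (mul_ne_zero h0 hz.1) (hP.mul_notMem h1 hz.2.1) hn
  have haz := ha.2 _ hz
  have := hP.add_mem (y := 1) (y' := 1 + a * z) (z := z) (z' := z) (by simpa using haz.2.2)
    (by rw [div_self hz.1]; exact hP.one_mem) (by simpa using hz.2.1)
  have e : 1 + a * z + z = 1 + (1 + a) * z := by ring
  rw [e, div_one] at this
  rcases this with h | h
  · refine (hP.mul_notMem h1 hz.2.1) (hP.subset ?_)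
    have := hP.div_mem h k
    rwa [div_div_cancel₀ (hP.ne_zero (hP.subset h))] at this
  · refine haT ?_
    have := hP.trans k1 (hP.comm_trans k h)
    rwa [mul_div_cancel_right₀ _ hz.1] at this

lemma pos_neg_one : Pos T H (-1) :=
  ⟨hP.subset hP.neg_one_mem, fun z hz => by simpa using hP.neg_neg hg ht hz⟩

lemma pos_one_add_of_mem {a : K} (ha : Pos T H a) (haT : a ∈ T) (h1 : 1 + a ∈ H) :
    Pos T H (1 + a) := by
  by_contra hnp
  have h0 := hP.ne_zero h1
  obtain ⟨z, hz, hn⟩ : ∃ z, Neg T H z ∧ ¬ Neg T H ((1 + a) * z) := by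
    by_contra! hc
    exact hnp ⟨h1, hc⟩
  have k1 := hP.one_add_pos_aux ha h1 hz hn
  rw [mul_div_mul_right _ _ hz.1] at k1
  have h1T : 1 + a ∈ T := by
    have := hP.div_mem haT k1
    rwa [div_div_cancel₀ (hP.ne_zero ha.1)] at this
  have hp := (hP.neg_or (mul_ne_zero h0 hz.1) (hP.mul_notMem h1 hz.2.1)).resolve_left hn
  have z0 := hz.1
  have hh0 := hP.ne_zero hg.1
  have hg0 := hP.ne_zero hg.2.1
  have k2 := hP.neg_mul_aux hg ht hz ((hP.pos_h hg ht).2 _ hp)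
  have e : 1 + z * (h * ((1 + a) * z)⁻¹) = (1 + h + a) / (1 + a) := by
    field_simp; ring
  rw [e] at k2
  have k3 : 1 + h + a ∈ T ∨ (1 + h + a) / z ∈ T := by
    refine k2.imp (fun k => ?_) (fun k => ?_)
    · have := hP.mul_mem _ k _ h1T
      rwa [div_mul_cancel₀ _ h0] at this
    · have := hP.mul_mem _ k _ h1T
      convert this using 1; field_simp
  have hginv : Pos T H (1 + h)⁻¹ := by
    have := hP.pos_mul (hP.pos_neg_one hg ht)
      (hP.pos_good hg ht (hP.good_inv (hP.good_neg hg ht)))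
    rwa [neg_one_mul, inv_neg, _root_.neg_neg] at this
  have hgpos : Pos T H (1 + h) := by
    have := hP.pos_mul (hP.pos_neg_one hg ht) (hP.pos_good hg ht (hP.good_neg hg ht))
    rwa [neg_one_mul, _root_.neg_neg] at this
  have m1 : Mem T H (1 + a * (1 + h)⁻¹) :=
    hP.mem_one_add_of_notMem hg ht (hP.pos_mul ha hginv) fun k => hg.2.2.1 (by
      have := hP.div_mem haT k
      have e : a / (a * (1 + h)⁻¹) = 1 + h := by
        have := hP.ne_zero ha.1
        field_simp
      rwa [e] at this)
  have m2 : Mem T H (-((1 + h + a) / h)) := by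
    have := hP.mem_mul hg ht (Or.inr (Or.inr (hP.pos_mul (hP.pos_mul (hP.pos_neg_one hg ht)
      (hP.pos_hinv hg ht)) hgpos))) m1
    convert this using 1
    field_simp
  have hnT : -((1 + h + a) / h) ∉ T := by
    intro k
    have k := hP.neg_mem k
    rw [_root_.neg_neg] at k
    rcases k3 with k' | k'
    · refine ht ?_
      have := hP.div_mem k' k
      rwa [div_div_cancel₀ (hP.ne_zero (hP.subset k'))] at this
    · refine hz.2.1 ?_
      have k4 : 1 + h + a ∈ H := by
        have := hP.mul_mem' _ (hP.subset k) _ hg.1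
        rwa [div_mul_cancel₀ _ hh0] at this
      have := hP.div_mem' k4 (hP.subset k')
      rwa [div_div_cancel₀ (hP.ne_zero k4)] at this
  have m3 : Mem T H (1 + -((1 + h + a) / h)) := by
    rcases m2 with k | k | k
    · rw [k, add_zero]
      have := hP.pos_mul (hP.pos_neg_one hg ht) (hP.pos_neg_one hg ht)
      exact Or.inr (Or.inr (by simpa using this))
    · exact Or.inr (Or.inr (hP.one_add_neg hg ht k))
    · exact hP.mem_one_add_of_notMem hg ht k hnT
  have m4 : Mem T H (1 + a) := by
    have := hP.mem_mul hg ht (Or.inr (Or.inr (hP.pos_mul (hP.pos_neg_one hg ht)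
      (hP.pos_h hg ht)))) m3
    convert this using 1
    field_simp; ring
  rcases m4 with k | k | k
  · exact h0 k
  · exact k.2.1 h1
  · exact hnp k

lemma mem_one : Mem T H 1 := by
  have := hP.pos_mul (hP.pos_neg_one hg ht) (hP.pos_neg_one hg ht)
  exact Or.inr (Or.inr (by simpa using this))

lemma mem_one_add {a : K} (ha : Mem T H a) : Mem T H (1 + a) := by
  rcases ha with rfl | ha | ha
  · simpa using hP.mem_one hg ht
  · exact Or.inr (Or.inr (hP.one_add_neg hg ht ha))
  · by_cases haT : a ∈ T
    · by_cases h0 : 1 + a = 0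
      · exact Or.inl h0
      by_cases h1 : 1 + a ∈ H
      · exact Or.inr (Or.inr (hP.pos_one_add_of_mem hg ht ha haT h1))
      · exact Or.inr (Or.inl (hP.one_add_pos_notMem hg ht ha h0 h1))
    · exact hP.mem_one_add_of_notMem hg ht ha haT

lemma mem_add {x y : K} (hx : Mem T H x) (hy : Mem T H y) : Mem T H (x + y) := by
  by_cases hx0 : x = 0
  · simpa [hx0]
  by_cases hy0 : y = 0
  · simpa [hy0]
  rcases hP.mem_or_inv hg ht (y / x) with k | k
  · have := hP.mem_mul hg ht hx (hP.mem_one_add hg ht k)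
    convert this using 1; field_simp
  · have := hP.mem_mul hg ht hy (hP.mem_one_add hg ht k)
    convert this using 1; field_simp; ring

/-- The valuation ring attached to a rigid pair with an exceptional element. -/
def valuationSubring : ValuationSubring K where
  carrier := {x | Mem T H x}
  mul_mem' := hP.mem_mul hg ht
  one_mem' := hP.mem_one hg ht
  add_mem' := hP.mem_add hg ht
  zero_mem' := Or.inl rfl
  neg_mem' {x} hx := by
    simpa using hP.mem_mul hg ht (Or.inr (Or.inr (hP.pos_neg_one hg ht))) hx
  mem_or_inv_mem' := hP.mem_or_inv hg ht

lemma mem_of_valuationSubring {x : K} (h0 : x ≠ 0) (h1 : x ∈ hP.valuationSubring hg ht)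
    (h2 : x⁻¹ ∈ hP.valuationSubring hg ht) : x ∈ H := by
  by_contra hx
  have k1 : Mem T H x := h1
  have k2 : Mem T H x⁻¹ := h2
  rcases k1 with k | k | k
  · exact h0 k
  · rcases k2 with k' | k' | k'
    · exact inv_ne_zero h0 k'
    · exact hP.neg_not k k'
    · exact hP.inv_notMem hx k'.1
  · exact hx k.1

end IsRigidPair

open scoped nonZeroDivisors in
/-- If `(r)` is the square of a fractional ideal then `r` has even value for every valuation that
is nonnegative on the ring of integers. -/
lemma exists_valuation_eq_sq_of_spanSingleton_eq_sq {R k Γ : Type*} [CommRing R] [IsDedekindDomain R]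
    [Field k] [Algebra R k] [IsFractionRing R k] [LinearOrderedCommGroupWithZero Γ]
    (v : Valuation k Γ) (hv : ∀ x : R, v (algebraMap R k x) ≤ 1) {r : k} (hr : r ≠ 0)
    {I : FractionalIdeal R⁰ k} (hI : FractionalIdeal.spanSingleton R⁰ r = I ^ 2) :
    ∃ s, s ≠ 0 ∧ v r = v s ^ 2 := by
  have hI0 : I ≠ 0 := by
    rintro rfl
    rw [zero_pow two_ne_zero, FractionalIdeal.spanSingleton_eq_zero_iff] at hI
    exact hr hI
  have hmul : I * I⁻¹ = 1 := mul_inv_cancel₀ hI0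
  obtain ⟨s, hs, b, hb, hsb⟩ : ∃ s ∈ I, ∃ b ∈ I⁻¹, 1 ≤ v (s * b) := by
    by_contra! hc
    have h1 : (1 : k) ∈ I * I⁻¹ := by rw [hmul]; exact FractionalIdeal.one_mem_one _
    have : v (1 : k) < 1 := by
      refine FractionalIdeal.mul_induction_on (C := fun x => v x < 1) h1 (fun i hi j hj => hc i hi j hj) ?_
      intro x y hx hy
      exact lt_of_le_of_lt (v.map_add x y) (max_lt hx hy)
    simp at this
  have hs2 : s * s ∈ FractionalIdeal.spanSingleton R⁰ r := by
    rw [hI, sq]; exact FractionalIdeal.mul_mem_mul hs hs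
  obtain ⟨x, hx⟩ := (FractionalIdeal.mem_spanSingleton _).1 hs2
  have hrb : r * (b * b) ∈ (1 : FractionalIdeal R⁰ k) := by
    have e : (1 : FractionalIdeal R⁰ k) = FractionalIdeal.spanSingleton R⁰ r * (I⁻¹ * I⁻¹) := by
      rw [hI, sq, mul_mul_mul_comm, hmul, one_mul]
    rw [e]
    exact FractionalIdeal.mul_mem_mul (FractionalIdeal.mem_spanSingleton_self _ _)
      (FractionalIdeal.mul_mem_mul hb hb)
  obtain ⟨y, hy⟩ := (FractionalIdeal.mem_one_iff _).1 hrb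
  refine ⟨s, ?_, le_antisymm ?_ ?_⟩
  · rintro rfl; simp at hsb
  · have h1 : v r * (v b * v b) ≤ 1 := by
      have := hv y
      rwa [hy, map_mul, map_mul] at this
    have h2 : 1 ≤ (v s * v b) * (v s * v b) := by
      rw [map_mul] at hsb; exact one_le_mul hsb hsb
    have h3 : v r * (v b * v b) ≤ v s ^ 2 * (v b * v b) := by
      refine h1.trans (h2.trans_eq ?_); rw [sq, mul_mul_mul_comm]
    have hb0 : 0 < v b * v b := by
      refine zero_lt_iff.2 fun h0 => ?_
      have : v b = 0 := by simpa using h0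
      rw [map_mul, this] at hsb; simp at hsb
    exact le_of_mul_le_mul_right h3 hb0
  · have := hv x
    rw [Algebra.smul_def] at hx
    rw [sq, ← map_mul, ← hx, map_mul]
    exact mul_le_of_le_one_left' this

open scoped nonZeroDivisors in
lemma exists_unit_mul_sq_of_spanSingleton_eq_sq {k K : Type*} [Field k] [NumberField k] [Field K]
    (ι : k →+* K) (O : ValuationSubring K) {r : k} (hr : r ≠ 0)
    {I : FractionalIdeal (NumberField.RingOfIntegers k)⁰ k}
    (hI : FractionalIdeal.spanSingleton (NumberField.RingOfIntegers k)⁰ r = I ^ 2) :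
    ∃ s, s ≠ 0 ∧ ι (r / s ^ 2) ∈ O ∧ (ι (r / s ^ 2))⁻¹ ∈ O := by
  obtain ⟨s, hs, h⟩ := exists_valuation_eq_sq_of_spanSingleton_eq_sq (O.valuation.comap ι)
    (fun x => by
      rw [Valuation.comap_apply, ValuationSubring.valuation_le_one_iff]
      have hx : IsIntegral ℤ (ι (algebraMap _ k x)) :=
        (NumberField.RingOfIntegers.isIntegral_coe x).map ι.toIntAlgHom
      have := IsIntegral.tower_top (A := O) hx
      obtain ⟨y, hy⟩ := IsIntegrallyClosed.isIntegral_iff.1 this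
      rw [← hy]; exact y.2) hr hI
  refine ⟨s, hs, ?_, ?_⟩
  all_goals
    have hvs : O.valuation (ι s) ≠ 0 := by simpa using hs
    have e : O.valuation (ι (r / s ^ 2)) = 1 := by
      simp only [Valuation.comap_apply] at h
      rw [map_div₀, map_div₀, map_pow, map_pow, h, div_self (pow_ne_zero 2 hvs)]
    rw [← ValuationSubring.valuation_le_one_iff]
  · exact e.le
  · rw [map_inv₀, e, inv_one]

section Transfer

variable {K L : Type*} [Field K] [Field L]

lemma sqCl_eq_iff {w w' : Lˣ} : sqCl w = sqCl w' ↔ ∃ t : Lˣ, w' = w * t ^ 2 := by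
  unfold sqCl
  rw [QuotientGroup.eq]
  constructor
  · rintro ⟨t, ht⟩
    exact ⟨t, by rw [← mul_inv_cancel_left w w', ← ht]; rfl⟩
  · rintro ⟨t, rfl⟩
    exact ⟨t, by simp⟩

lemma sqCl_mul (w w' : Lˣ) : sqCl (w * w') = sqCl w * sqCl w' := rfl

lemma sqCl_inv (w : Lˣ) : sqCl w⁻¹ = (sqCl w)⁻¹ := rfl

lemma exists_sqCl_eq (x : SqClass L) : ∃ w : Lˣ, x = sqCl w := by
  obtain ⟨w, hw⟩ := QuotientGroup.mk_surjective x
  exact ⟨w, hw.symm⟩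

/-- The preimage of a set of (square classes of) elements of `L`. -/
def sqPreimage (α : SqClass K ≃* SqClass L) (S : Set L) : Set K :=
  {x | ∃ (u : Kˣ) (w : Lˣ), (u : K) = x ∧ α (sqCl u) = sqCl w ∧ (w : L) ∈ S}

variable {α : SqClass K ≃* SqClass L} {S : Set L}

lemma mem_sqPreimage_iff (hS : ∀ x ∈ S, ∀ y, y ≠ 0 → x * y ^ 2 ∈ S) {u : Kˣ} {w : Lˣ}
    (h : α (sqCl u) = sqCl w) : (u : K) ∈ sqPreimage α S ↔ (w : L) ∈ S := by
  constructor
  · rintro ⟨u', w', hu, hw, hwS⟩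
    obtain rfl := Units.ext hu
    obtain ⟨t, rfl⟩ := sqCl_eq_iff.1 (hw.symm.trans h)
    simpa using hS _ hwS t t.ne_zero
  · exact fun hw => ⟨u, w, rfl, h, hw⟩

lemma mem_sqPreimage_sq {x y : K} (hy : y ≠ 0)
    (hx : x ∈ sqPreimage α S) : x * y ^ 2 ∈ sqPreimage α S := by
  obtain ⟨u, w, rfl, hw, hwS⟩ := hx
  refine ⟨u * (Units.mk0 y hy) ^ 2, w, by simp, ?_, hwS⟩
  rw [← hw]
  exact congrArg α (sqCl_eq_iff.2 ⟨_, rfl⟩).symm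

variable {T H : Set L}

lemma IsRigidPair.sq_mul_mem (hP : IsRigidPair T H) (hsq : ∀ y : L, y ≠ 0 → y ^ 2 ∈ T) :
    ∀ x ∈ T, ∀ y, y ≠ 0 → x * y ^ 2 ∈ T :=
  fun _ hx y hy => hP.mul_mem _ hx _ (hsq y hy)

lemma IsRigidPair.sq_mul_mem' (hP : IsRigidPair T H) (hsq : ∀ y : L, y ≠ 0 → y ^ 2 ∈ T) :
    ∀ x ∈ H, ∀ y, y ≠ 0 → x * y ^ 2 ∈ H :=
  fun _ hx y hy => hP.mul_mem' _ hx _ (hP.subset (hsq y hy))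

lemma IsRigidPair.sqPreimage (hP : IsRigidPair T H) (hsq : ∀ y : L, y ≠ 0 → y ^ 2 ∈ T)
    (hα : IsWittEquiv α) : IsRigidPair (sqPreimage α T) (sqPreimage α H) where
  zero_notMem := by
    rintro ⟨u, w, hu, -⟩
    exact u.ne_zero hu
  subset := by
    rintro _ ⟨u, w, rfl, h, hw⟩
    exact ⟨u, w, rfl, h, hP.subset hw⟩
  neg_one_mem := ⟨-1, -1, by simp, hα.map_neg_one, by simpa using hP.neg_one_mem⟩
  mul_mem := by
    rintro _ ⟨u, w, rfl, h, hw⟩ _ ⟨u', w', rfl, h', hw'⟩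
    exact ⟨u * u', w * w', by simp, by rw [sqCl_mul, map_mul, h, h', sqCl_mul],
      by simpa using hP.mul_mem _ hw _ hw'⟩
  mul_mem' := by
    rintro _ ⟨u, w, rfl, h, hw⟩ _ ⟨u', w', rfl, h', hw'⟩
    exact ⟨u * u', w * w', by simp, by rw [sqCl_mul, map_mul, h, h', sqCl_mul],
      by simpa using hP.mul_mem' _ hw _ hw'⟩
  inv_mem := by
    rintro _ ⟨u, w, rfl, h, hw⟩
    exact ⟨u⁻¹, w⁻¹, by simp, by rw [sqCl_inv, map_inv, h, sqCl_inv],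
      by simpa using hP.inv_mem _ hw⟩
  inv_mem' := by
    rintro _ ⟨u, w, rfl, h, hw⟩
    exact ⟨u⁻¹, w⁻¹, by simp, by rw [sqCl_inv, map_inv, h, sqCl_inv],
      by simpa using hP.inv_mem' _ hw⟩
  rigid := by
    intro x hx0 hxH
    obtain ⟨w, hw⟩ := exists_sqCl_eq (α (sqCl (Units.mk0 x hx0)))
    have hwH : (w : L) ∉ H := fun h => hxH ⟨_, w, rfl, hw, h⟩
    have h1 : 1 + x ≠ 0 := by
      intro h
      refine hxH ⟨-1, -1, ?_, hα.map_neg_one, by simpa using hP.subset hP.neg_one_mem⟩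
      rw [Units.val_neg, Units.val_one]
      exact neg_eq_of_add_eq_zero_right h
    obtain ⟨w', hw'⟩ := exists_sqCl_eq (α (sqCl (Units.mk0 _ h1)))
    have h11 : α (sqCl (1 : Kˣ)) = sqCl (1 : Lˣ) := map_one α
    obtain ⟨p, q, hpq⟩ := (hα.represents 1 (Units.mk0 x hx0) (Units.mk0 _ h1) 1 w w' h11 hw hw').1
      ⟨1, 1, by simp⟩
    rw [Units.val_one, one_mul] at hpq
    have key : (w' : L) ∈ T ∨ (w' : L) / w ∈ T := by
      by_cases hq : q = 0
      · left
        have hp : p ≠ 0 := by rintro rfl; simp [hq] at hpq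
        simpa [hpq, hq] using hsq p hp
      by_cases hp : p = 0
      · right
        simpa [hpq, hp] using hsq q hq
      have hqp : q / p ≠ 0 := div_ne_zero hq hp
      have hn : (w : L) * (q / p) ^ 2 ∉ H := fun h => hwH (by
        have := hP.sq_mul_mem' hsq _ h _ (inv_ne_zero hqp)
        rwa [mul_assoc, ← mul_pow, mul_inv_cancel₀ hqp, one_pow, mul_one] at this)
      have w0 := w.ne_zero
      rcases hP.rigid _ (mul_ne_zero w.ne_zero (pow_ne_zero 2 hqp)) hn with h | h
      · left
        have := hP.sq_mul_mem hsq _ h _ hp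
        convert this using 1
        rw [hpq]; field_simp
      · right
        have := hP.sq_mul_mem hsq _ h _ hq
        convert this using 1
        rw [hpq]; field_simp
    refine key.imp (fun h => ⟨_, w', rfl, hw', h⟩) fun h => ⟨Units.mk0 _ h1 * (Units.mk0 x hx0)⁻¹,
      w' * w⁻¹, by simp [div_eq_mul_inv], ?_, by simpa [div_eq_mul_inv] using h⟩
    rw [sqCl_mul, map_mul, sqCl_inv, map_inv, hw, hw']; rfl

lemma IsRigidPair.exists_good_sqPreimage (hP : IsRigidPair T H)
    (hsq : ∀ y : L, y ≠ 0 → y ^ 2 ∈ T) (hα : IsWittEquiv α) {h : L}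
    (hg : IsRigidPair.Good T H h) (ht : h ∉ T) :
    ∃ h', IsRigidPair.Good (_root_.sqPreimage α T) (_root_.sqPreimage α H) h' ∧
      h' ∉ _root_.sqPreimage α T := by
  have hsqT := hP.sq_mul_mem hsq
  have hsqH := hP.sq_mul_mem' hsq
  obtain ⟨h1, h2, h3, h4⟩ := hg
  have h0 := hP.ne_zero h1
  have g0 := hP.ne_zero h2
  obtain ⟨u, hu⟩ := exists_sqCl_eq (α.symm (sqCl (Units.mk0 h h0)))
  obtain ⟨z, hz⟩ := exists_sqCl_eq (α.symm (sqCl (Units.mk0 _ g0)))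
  rw [MulEquiv.symm_apply_eq] at hu hz
  obtain ⟨p, q, hpq⟩ := (hα.represents 1 u z 1 _ _ (map_one α) hu.symm hz.symm).2
    ⟨1, 1, by simp⟩
  rw [Units.val_one, one_mul] at hpq
  have hzT : (z : K) ∉ _root_.sqPreimage α T := by
    rw [mem_sqPreimage_iff hsqT hz.symm]; exact h3
  have huT : (u : K) ∉ _root_.sqPreimage α T := by
    rw [mem_sqPreimage_iff hsqT hu.symm]; exact ht
  have hzH : (z : K) ∈ _root_.sqPreimage α H := by
    rw [mem_sqPreimage_iff hsqH hz.symm]; exact h2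
  have huH : (u : K) ∈ _root_.sqPreimage α H := by
    rw [mem_sqPreimage_iff hsqH hu.symm]; exact h1
  have hzu : (z : K) / u ∉ _root_.sqPreimage α T := by
    have e : (z : K) / u = ((z * u⁻¹ : Kˣ) : K) := by simp [div_eq_mul_inv]
    rw [e, mem_sqPreimage_iff hsqT (w := Units.mk0 _ g0 * (Units.mk0 h h0)⁻¹)]
    · simpa [div_eq_mul_inv] using h4
    · rw [sqCl_mul, map_mul, sqCl_inv, map_inv, ← hu, ← hz]; rfl
  have hsqK : ∀ y : K, y ≠ 0 → y ^ 2 ∈ _root_.sqPreimage α T := fun y hy => by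
    have := mem_sqPreimage_sq hy (hP.sqPreimage hsq hα).one_mem
    rwa [one_mul] at this
  have hp : p ≠ 0 := by
    rintro rfl
    refine hzu ?_
    have hq : q ≠ 0 := by rintro rfl; simp at hpq
    have := hsqK q hq
    convert this using 1
    rw [hpq]; simp
  have hq : q ≠ 0 := by
    rintro rfl
    refine hzT ?_
    have := hsqK p hp
    convert this using 1
    rw [hpq]; simp
  have hqp : q / p ≠ 0 := div_ne_zero hq hp
  have u0 := u.ne_zero
  have e : 1 + (u : K) * (q / p) ^ 2 = z * p⁻¹ ^ 2 := by rw [hpq]; field_simp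
  have conv : ∀ {x y : K}, y ≠ 0 → x * y ^ 2 ∈ _root_.sqPreimage α T → x ∈ _root_.sqPreimage α T := by
    intro x y hy hx
    have := mem_sqPreimage_sq (inv_ne_zero hy) hx
    rwa [mul_assoc, ← mul_pow, mul_inv_cancel₀ hy, one_pow, mul_one] at this
  refine ⟨u * (q / p) ^ 2, ⟨mem_sqPreimage_sq hqp huH, ?_, ?_, ?_⟩, fun k => huT (conv hqp k)⟩
  · rw [e]; exact mem_sqPreimage_sq (inv_ne_zero hp) hzH
  · rw [e]; exact fun k => hzT (conv (inv_ne_zero hp) k)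
  · rw [e]; intro k
    refine hzu (conv (inv_ne_zero hq) ?_)
    convert k using 1
    field_simp

open scoped nonZeroDivisors in
/-- If the ideal `(r)` is a square, then the image of `r` under a Witt equivalence lies in the big
group of every rigid pair (with exceptional element) of the target. -/
theorem IsRigidPair.mem_of_isWittEquiv (hP : IsRigidPair T H)
    (hsq : ∀ y : L, y ≠ 0 → y ^ 2 ∈ T) {h : L}
    (hg : IsRigidPair.Good T H h) (ht : h ∉ T) (hα : IsWittEquiv α)
    {k : Type*} [Field k] [NumberField k] (ι : k →+* K) {r : kˣ}
    {I : FractionalIdeal (NumberField.RingOfIntegers k)⁰ k}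
    (hI : FractionalIdeal.spanSingleton (NumberField.RingOfIntegers k)⁰ (r : k) = I ^ 2)
    {w : Lˣ} (hw : α (sqCl (Units.map ι.toMonoidHom r)) = sqCl w) : (w : L) ∈ H := by
  have hP' := hP.sqPreimage hsq hα
  obtain ⟨h', hg', ht'⟩ := hP.exists_good_sqPreimage hsq hα hg ht
  obtain ⟨s, hs, h1, h2⟩ := exists_unit_mul_sq_of_spanSingleton_eq_sq ι
    (hP'.valuationSubring hg' ht') r.ne_zero hI
  have hs' : ι s ≠ 0 := by simpa using hs
  have := hP'.mem_of_valuationSubring hg' ht' (by simp [hs]) h1 h2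
  rw [← mem_sqPreimage_iff (hP.sq_mul_mem' hsq) hw]
  have := mem_sqPreimage_sq hs' this
  convert this using 1
  simp [hs']

end Transfer

section ValuationPair

variable {L Γ : Type*} [Field L] [LinearOrderedCommGroupWithZero Γ] (v : Valuation L Γ)

/-- Elements that become principal units after multiplication by a sign and a square. -/
def Valuation.principalSq : Set L := {x | ∃ ε y, ε ^ 2 = 1 ∧ v (ε * x * y ^ 2 - 1) < 1}

/-- Elements of even value. -/
def Valuation.unitSq : Set L := {x | ∃ y, v (x * y ^ 2) = 1}

variable {v}

lemma Valuation.eq_one_of_sub_one_lt {x : L} (h : v (x - 1) < 1) : v x = 1 := by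
  have := v.map_add_eq_of_lt_right (x := x - 1) (y := 1) (by simpa using h)
  simpa using this

lemma Valuation.map_eq_one_of_sq_eq_one {ε : L} (h : ε ^ 2 = 1) : v ε = 1 := by
  rcases (show ε = 1 ∨ ε = -1 by rwa [← sq_eq_sq_iff_eq_or_eq_neg, one_pow]) with rfl | rfl <;> simp

variable (v) in
lemma Valuation.isRigidPair : IsRigidPair v.principalSq v.unitSq where
  zero_notMem := by
    rintro ⟨y, hy⟩
    simp at hy
  subset := by
    rintro x ⟨ε, y, hε, h⟩
    refine ⟨y, ?_⟩
    have := Valuation.eq_one_of_sub_one_lt h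
    rwa [mul_assoc, map_mul, Valuation.map_eq_one_of_sq_eq_one hε, one_mul] at this
  neg_one_mem := ⟨-1, 1, by norm_num, by simp⟩
  mul_mem := by
    rintro x ⟨ε, y, hε, h⟩ x' ⟨ε', y', hε', h'⟩
    refine ⟨ε * ε', y * y', by rw [mul_pow, hε, hε', one_mul], ?_⟩
    have e : ε * ε' * (x * x') * (y * y') ^ 2 - 1 =
      (ε * x * y ^ 2 - 1) * (ε' * x' * y' ^ 2) + (ε' * x' * y' ^ 2 - 1) := by ring
    rw [e]
    refine lt_of_le_of_lt (v.map_add _ _) (max_lt ?_ h')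
    rw [map_mul, Valuation.eq_one_of_sub_one_lt h', mul_one]; exact h
  inv_mem := by
    rintro x ⟨ε, y, hε, h⟩
    have h1 := Valuation.eq_one_of_sub_one_lt h
    have h0 : ε * x * y ^ 2 ≠ 0 := fun h0 => by simp [h0] at h1
    have hx : x ≠ 0 := by rintro rfl; simp at h0
    have hy : y ≠ 0 := by rintro rfl; simp at h0
    have hε0 : ε ≠ 0 := by rintro rfl; simp at h0
    refine ⟨ε⁻¹, y⁻¹, by rw [inv_pow, hε, inv_one], ?_⟩
    have e : ε⁻¹ * x⁻¹ * y⁻¹ ^ 2 - 1 = -((ε * x * y ^ 2 - 1) * (ε * x * y ^ 2)⁻¹) := by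
      field_simp; ring
    rw [e, Valuation.map_neg, map_mul, map_inv₀, h1, inv_one, mul_one]
    exact h
  mul_mem' := by
    rintro x ⟨y, hy⟩ x' ⟨y', hy'⟩
    refine ⟨y * y', ?_⟩
    have e : x * x' * (y * y') ^ 2 = (x * y ^ 2) * (x' * y' ^ 2) := by ring
    rw [e, map_mul, hy, hy', one_mul]
  inv_mem' := by
    rintro x ⟨y, hy⟩
    refine ⟨y⁻¹, ?_⟩
    have e : x⁻¹ * y⁻¹ ^ 2 = (x * y ^ 2)⁻¹ := by rw [inv_pow, mul_inv]
    rw [e, map_inv₀, hy, inv_one]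
  rigid := by
    intro x hx0 hx
    have h1 : v x ≠ 1 := fun h => hx ⟨1, by simpa using h⟩
    rcases h1.lt_or_gt with h | h
    · exact Or.inl ⟨1, 1, by simp, by simpa using h⟩
    · refine Or.inr ⟨1, 1, by simp, ?_⟩
      have e : 1 * ((1 + x) / x) * 1 ^ 2 - 1 = x⁻¹ := by field_simp; ring
      rw [e, map_inv₀]
      exact inv_lt_one_of_one_lt₀ h

lemma Valuation.sq_mem_principalSq {y : L} (hy : y ≠ 0) : y ^ 2 ∈ v.principalSq :=
  ⟨1, y⁻¹, by simp, by simp [hy]⟩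

lemma Valuation.good {h : L} (h1 : v h = 1) (h2 : v (1 + h) = 1) (h3 : 1 + h ∉ v.principalSq)
    (h4 : h * (1 + h) ∉ v.principalSq) : IsRigidPair.Good v.principalSq v.unitSq h := by
  refine ⟨⟨1, by simpa using h1⟩, ⟨1, by simpa using h2⟩, h3, fun h5 => h4 ?_⟩
  have h0 : h ≠ 0 := by rintro rfl; simp at h1
  have := v.isRigidPair.mul_mem _ h5 _ (Valuation.sq_mem_principalSq h0)
  convert this using 1
  field_simp

lemma Valuation.comap_principalSq {F : Type*} [Field F] (φ : F →+* L) {x : F}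
    (h : φ x ∉ v.principalSq) : x ∉ (v.comap φ).principalSq := by
  rintro ⟨ε, y, hε, hv⟩
  refine h ⟨φ ε, φ y, by rw [← map_pow, hε, map_one], ?_⟩
  simpa using hv

lemma Valuation.comap_unitSq {F : Type*} [Field F] (φ : F →+* L) {x : F}
    (h : φ x ∉ v.unitSq) : x ∉ (v.comap φ).unitSq := by
  rintro ⟨y, hv⟩
  exact h ⟨φ y, by simpa using hv⟩

end ValuationPair

section Uniformization

open IntermediateField

/-- `x, y` generate `L` over `l` and lie on the conic `a x² + b y² = 1`. -/
structure IsConicGen (l : Type*) {L : Type*} [Field l] [Field L] [Algebra l L] (a b : l)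
    (x y : L) : Prop where
  eq : algebraMap l L a * x ^ 2 + algebraMap l L b * y ^ 2 = 1
  adjoin : IntermediateField.adjoin l {x, y} = ⊤

lemma IsConicFunctionField.exists_isConicGen {l L : Type*} [Field l] [Field L] [Algebra l L]
    {a b : l} (h : IsConicFunctionField l a b L (algebraMap l L)) :
    ∃ x y, IsConicGen l a b (x : L) y := by
  obtain ⟨f, hf, hι, hz⟩ := h
  have hC : ∀ c : l, f (Ideal.Quotient.mk _ (C c)) = algebraMap l L c := fun c => by
    rw [← hι]; rfl
  refine ⟨f (Ideal.Quotient.mk _ (X 0)), f (Ideal.Quotient.mk _ (X 1)), ?_, ?_⟩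
  · have h0 : f (Ideal.Quotient.mk (Ideal.span {conicPoly l a b}) (conicPoly l a b)) = 0 := by
      rw [Ideal.Quotient.eq_zero_iff_mem.2 (Ideal.mem_span_singleton_self _), map_zero]
    have h1 : f (Ideal.Quotient.mk (Ideal.span {conicPoly l a b})
      (C a * X 0 ^ 2 + C b * X 1 ^ 2 - 1)) = 0 := h0
    simp only [map_sub, map_add, map_mul, map_pow, map_one, hC] at h1
    exact sub_eq_zero.1 h1
  · rw [eq_top_iff]
    have key : ∀ p, f p ∈ IntermediateField.adjoin l {f (Ideal.Quotient.mk _ (X 0)),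
        f (Ideal.Quotient.mk _ (X 1))} := by
      intro p
      obtain ⟨P, rfl⟩ := Ideal.Quotient.mk_surjective p
      induction P using MvPolynomial.induction_on with
      | C c => rw [hC]; exact IntermediateField.algebraMap_mem _ c
      | add p q hp hq => rw [map_add, map_add]; exact add_mem hp hq
      | mul_X p i hp =>
        rw [map_mul, map_mul]
        refine mul_mem hp ?_
        apply IntermediateField.subset_adjoin
        fin_cases i <;> simp
    intro z _
    obtain ⟨p, q, -, rfl⟩ := hz z
    exact div_mem (key p) (key q)

lemma IsConicFunctionField.not_isAlgebraic {l L : Type*} [Field l] [Field L] [Algebra l L]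
    {a b : l} (hb : b ≠ 0) (h : IsConicFunctionField l a b L (algebraMap l L)) :
    ¬ Algebra.IsAlgebraic l L := by
  obtain ⟨f, hf, hι, -⟩ := h
  intro halg
  obtain ⟨P, hP0, hP⟩ := halg.isAlgebraic (f (Ideal.Quotient.mk _ (X 0)))
  have h1 : f (Ideal.Quotient.mk _ (Polynomial.aeval (X 0 : MvPolynomial (Fin 2) l) P)) = 0 := by
    rw [← hP, Polynomial.aeval_def, Polynomial.aeval_def, Polynomial.hom_eval₂,
      Polynomial.hom_eval₂]
    congr 1
  rw [map_eq_zero_iff f hf, Ideal.Quotient.eq_zero_iff_mem, Ideal.mem_span_singleton] at h1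
  obtain ⟨Q, hQ⟩ := h1
  refine hP0 ?_
  apply Polynomial.map_injective (algebraMap l (AlgebraicClosure l)) (algebraMap l _).injective
  rw [Polynomial.map_zero]
  refine Polynomial.eq_zero_of_infinite_isRoot _ (Set.infinite_univ.mono fun z _ => ?_)
  obtain ⟨w, hw⟩ := IsAlgClosed.exists_pow_nat_eq
    ((1 - algebraMap l (AlgebraicClosure l) a * z ^ 2) / algebraMap l _ b) (n := 2) (by norm_num)
  have hb' : algebraMap l (AlgebraicClosure l) b ≠ 0 := by simpa using hb
  have e := congrArg (MvPolynomial.aeval ![z, w]) hQ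
  rw [map_mul, conicPoly] at e
  simp only [map_sub, map_add, map_mul, map_pow, map_one, MvPolynomial.aeval_X,
    MvPolynomial.algHom_C, Matrix.cons_val_zero, Matrix.cons_val_one, hw] at e
  rw [mul_div_cancel₀ _ hb'] at e
  rw [← Polynomial.aeval_algHom_apply] at e
  simp at e
  simpa [Polynomial.IsRoot, Polynomial.eval_map_algebraMap] using e

variable {l L : Type*} [Field l] [Field L] [Algebra l L]

lemma IsConicGen.not_isIntegral {a b : l} {x y : L} (h : IsConicGen l a b x y)
    (hna : ¬ Algebra.IsAlgebraic l L) : ¬ (IsIntegral l x ∧ IsIntegral l y) := by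
  rintro ⟨hx, hy⟩
  have := isAlgebraic_adjoin_pair hx hy
  rw [h.adjoin] at this
  exact hna ((IntermediateField.topEquiv (F := l) (E := L)).isAlgebraic)

lemma IsConicGen.ne_zero {a b : l} (ha : a ≠ 0) {x y : L}
    (h : IsConicGen l a b x y) (hna : ¬ Algebra.IsAlgebraic l L) : y ≠ 0 := by
  rintro rfl
  refine h.not_isIntegral hna ⟨?_, isIntegral_zero⟩
  have h1 := h.eq
  have ha' : algebraMap l L a ≠ 0 := by simpa using ha
  have : x ^ 2 = algebraMap l L a⁻¹ := by
    rw [map_inv₀]; field_simp; simpa [mul_comm] using h1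
  exact IsIntegral.of_pow two_pos (this ▸ isIntegral_algebraMap)

lemma exists_eq_add_mul_of_mem_adjoin {Ω : Type*} [Field Ω] [Algebra l Ω] {a : l} {s : Ω}
    (hs : s ^ 2 = algebraMap l Ω a) {z : Ω} (hz : z ∈ l⟮s⟯) :
    ∃ c₀ c₁ : l, z = algebraMap l Ω c₀ + algebraMap l Ω c₁ * s := by
  induction hz using IntermediateField.adjoin_induction with
  | mem u hu => exact ⟨0, 1, by simpa using hu⟩
  | algebraMap c => exact ⟨c, 0, by simp⟩
  | add u w _ _ hu hw =>
    obtain ⟨c, d, rfl⟩ := hu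
    obtain ⟨c', d', rfl⟩ := hw
    exact ⟨c + c', d + d', by simp only [map_add]; ring⟩
  | inv u _ hu =>
    obtain ⟨c, d, rfl⟩ := hu
    by_cases hn : c ^ 2 - a * d ^ 2 = 0
    · have e : (algebraMap l Ω c + algebraMap l Ω d * s) *
        (algebraMap l Ω c - algebraMap l Ω d * s) = 0 := by
        have := congrArg (algebraMap l Ω) hn
        simp only [map_sub, map_mul, map_pow, map_zero, ← hs] at this
        linear_combination this
      rcases mul_eq_zero.1 e with h | h
      · exact ⟨0, 0, by simp [h]⟩
      · refine ⟨(2 * c)⁻¹, 0, ?_⟩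
        rw [← sub_eq_zero.1 h, map_inv₀, map_mul, map_ofNat, map_zero]
        ring
    · refine ⟨c / (c ^ 2 - a * d ^ 2), -d / (c ^ 2 - a * d ^ 2), ?_⟩
      have hn' : algebraMap l Ω (c ^ 2 - a * d ^ 2) ≠ 0 :=
        (map_ne_zero _).2 hn
      apply inv_eq_of_mul_eq_one_right
      simp only [map_div₀, map_neg]
      field_simp
      simp only [map_sub, map_mul, map_pow, ← hs]
      ring
  | mul u w _ _ hu hw =>
    obtain ⟨c, d, rfl⟩ := hu
    obtain ⟨c', d', rfl⟩ := hw
    refine ⟨c * c' + a * d * d', c * d' + c' * d, ?_⟩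
    simp only [map_add, map_mul, ← hs]
    ring

/-- A conic function field embeds into a rational function field over a quadratic extension. -/
lemma IsConicGen.exists_embedding [CharZero l] {a b : l} (ha : a ≠ 0) (hb : b ≠ 0) {x y : L}
    (h : IsConicGen l a b x y) (hna : ¬ Algebra.IsAlgebraic l L) :
    ∃ (E : IntermediateField l (AlgebraicClosure L)) (s : E) (φ : L →+* RatFunc E),
      s ^ 2 = algebraMap l E a ∧ (∀ e : E, ∃ c₀ c₁ : l, e = algebraMap l E c₀ + algebraMap l E c₁ * s) ∧
      (∀ c : l, φ (algebraMap l L c) = RatFunc.C (algebraMap l E c)) ∧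
      φ y ≠ 0 ∧
      φ (2 / y) = RatFunc.X + RatFunc.C (algebraMap l E b) / RatFunc.X ∧
      RatFunc.C s * φ (2 * x / y) = RatFunc.X - RatFunc.C (algebraMap l E b) / RatFunc.X := by
  have hy := h.ne_zero ha hna
  have : CharZero L := charZero_of_injective_algebraMap (algebraMap l L).injective
  obtain ⟨s₀, hs₀⟩ := IsAlgClosed.exists_pow_nat_eq (algebraMap l (AlgebraicClosure L) a)
    (n := 2) (by norm_num)
  have hsint : IsIntegral l s₀ := IsIntegral.of_pow two_pos (hs₀ ▸ isIntegral_algebraMap)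
  let E := l⟮s₀⟯
  let s : E := AdjoinSimple.gen l s₀
  have hs : s ^ 2 = algebraMap l E a := by
    apply Subtype.ext; exact hs₀
  set x' := algebraMap L (AlgebraicClosure L) x with hx'
  set y' := algebraMap L (AlgebraicClosure L) y with hy'
  have hy0 : y' ≠ 0 := by simpa [hy'] using hy
  have heq : algebraMap l (AlgebraicClosure L) a * x' ^ 2 +
      algebraMap l (AlgebraicClosure L) b * y' ^ 2 = 1 := by
    have := congrArg (algebraMap L (AlgebraicClosure L)) h.eq
    simpa [← IsScalarTower.algebraMap_apply] using this
  set b' := algebraMap l (AlgebraicClosure L) b with hb'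
  have hb0 : b' ≠ 0 := by simpa [hb'] using hb
  have hprod : (1 + s₀ * x') * (1 - s₀ * x') = b' * y' ^ 2 := by
    rw [← hs₀] at heq; linear_combination -heq
  have h1 : 1 + s₀ * x' ≠ 0 := by
    intro h0
    rw [h0, zero_mul] at hprod
    exact mul_ne_zero hb0 (pow_ne_zero 2 hy0) hprod.symm
  set t := (1 + s₀ * x') / y' with ht
  have ht0 : t ≠ 0 := div_ne_zero h1 hy0
  have hbt : b' / t = (1 - s₀ * x') / y' := by
    rw [ht]; field_simp; linear_combination -hprod
  have hsum : 2 / y' = t + b' / t := by rw [hbt, ht]; field_simp; ring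
  have hdiff : s₀ * (2 * x' / y') = t - b' / t := by rw [hbt, ht]; field_simp; ring
  have hs0 : s₀ ≠ 0 := by
    rintro rfl
    refine ha ((algebraMap l (AlgebraicClosure L)).injective ?_)
    rw [← hs₀, map_zero, zero_pow two_ne_zero]
  have htr : Transcendental E t := by
    intro halg
    have : Algebra.IsAlgebraic l E := isAlgebraic_adjoin_simple hsint
    have h2 : IsAlgebraic l t := halg.restrictScalars l
    have h3 : IsIntegral l t := h2.isIntegral
    have hbi : IsIntegral l b' := isIntegral_algebraMap
    have hdi : ∀ {u w : AlgebraicClosure L}, IsIntegral l u → IsIntegral l w → IsIntegral l (u / w) :=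
      fun hu hw => by
        rw [div_eq_mul_inv]; exact hu.mul hw.inv
    have h2i : IsIntegral l (2 : AlgebraicClosure L) := by
      have := isIntegral_algebraMap (R := l) (A := AlgebraicClosure L) (x := 2)
      rwa [map_ofNat] at this
    have hyi : IsIntegral l y' := by
      have : y' = 2 / (t + b' / t) := by rw [← hsum]; field_simp
      rw [this]
      exact hdi h2i (h3.add (hdi hbi h3))
    have hxi : IsIntegral l x' := by
      have : x' = (t - b' / t) / s₀ * (y' / 2) := by rw [← hdiff]; field_simp
      rw [this]
      exact (hdi (h3.sub (hdi hbi h3)) hsint).mul (hdi hyi h2i)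
    refine h.not_isIntegral hna ⟨?_, ?_⟩
    · exact (isIntegral_algebraMap_iff (algebraMap L (AlgebraicClosure L)).injective).1 hxi
    · exact (isIntegral_algebraMap_iff (algebraMap L (AlgebraicClosure L)).injective).1 hyi
  let e := RatFunc.algEquivOfTranscendental t htr
  have htm : t ∈ E⟮t⟯ := mem_adjoin_simple_self E t
  have hlm : ∀ c : l, algebraMap l (AlgebraicClosure L) c ∈ E⟮t⟯ := fun c => by
    rw [IsScalarTower.algebraMap_apply l E]; exact IntermediateField.algebraMap_mem _ _
  have hsm : s₀ ∈ E⟮t⟯ := IntermediateField.algebraMap_mem E⟮t⟯ s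
  have h2m : (2 : AlgebraicClosure L) ∈ E⟮t⟯ := by
    have := hlm 2
    rwa [map_ofNat] at this
  have hym : y' ∈ E⟮t⟯ := by
    have : y' = 2 / (t + b' / t) := by rw [← hsum]; field_simp
    rw [this]
    exact div_mem h2m (add_mem htm (div_mem (hlm b) htm))
  have hxm : x' ∈ E⟮t⟯ := by
    have : x' = (t - b' / t) / s₀ * (y' / 2) := by rw [← hdiff]; field_simp
    rw [this]
    exact mul_mem (div_mem (sub_mem htm (div_mem (hlm b) htm)) hsm) (div_mem hym h2m)
  have hall : ∀ z : L, algebraMap L (AlgebraicClosure L) z ∈ E⟮t⟯ := by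
    intro z
    have hz : z ∈ IntermediateField.adjoin l {x, y} := by rw [h.adjoin]; trivial
    induction hz using IntermediateField.adjoin_induction with
    | mem u hu =>
      rcases hu with rfl | hu
      · exact hxm
      · rw [Set.mem_singleton_iff.1 hu]; exact hym
    | algebraMap c => rw [← IsScalarTower.algebraMap_apply]; exact hlm c
    | add u w _ _ hu hw => rw [map_add]; exact add_mem hu hw
    | inv u _ hu => rw [map_inv₀]; exact inv_mem hu
    | mul u w _ _ hu hw => rw [map_mul]; exact mul_mem hu hw
  let ψ : L →+* E⟮t⟯ := (algebraMap L (AlgebraicClosure L)).codRestrict E⟮t⟯.toSubring hall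
  have hψ : ∀ z, ((ψ z : E⟮t⟯) : AlgebraicClosure L) = algebraMap L _ z := fun z => rfl
  have heX : ((e RatFunc.X : E⟮t⟯) : AlgebraicClosure L) = t := by
    simp [e]
  have heC : ∀ c : E, ((e (RatFunc.C c) : E⟮t⟯) : AlgebraicClosure L) = c := fun c => by
    have : RatFunc.C c = algebraMap E (RatFunc E) c := rfl
    rw [this, e.commutes]; rfl
  refine ⟨E, s, (e.symm : E⟮t⟯ →+* RatFunc E).comp ψ, hs, ?_, ?_, ?_, ?_, ?_⟩
  · intro z
    obtain ⟨c₀, c₁, hz⟩ := exists_eq_add_mul_of_mem_adjoin hs₀ z.2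
    exact ⟨c₀, c₁, Subtype.ext hz⟩
  · intro c
    apply e.injective
    apply Subtype.ext
    rw [heC]
    simp [hψ]
    rfl
  · simpa using hy
  · apply e.injective
    apply Subtype.ext
    have := heC (algebraMap l E b)
    simp only [RingHom.comp_apply, RingHom.coe_coe, AlgEquiv.apply_symm_apply, map_add, map_div₀]
    push_cast
    rw [heX, this, map_ofNat]
    exact hsum
  · apply e.injective
    apply Subtype.ext
    have := heC (algebraMap l E b)
    simp only [RingHom.comp_apply, RingHom.coe_coe, AlgEquiv.apply_symm_apply, map_sub, map_div₀, map_mul]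
    push_cast
    rw [heX, this, heC, map_ofNat]
    exact hdiff

end Uniformization

section Unramified

open NumberField IsDedekindDomain WithZero

/-- A positive integer exactly divisible once by an unramified prime is not a square up to sign. -/
lemma NumberField.mul_natCast_ne_sq {F : Type*} [Field F] [NumberField F] {p u : ℕ} (hp : p.Prime)
    (hd : ¬ p ∣ Ideal.absNorm (differentIdeal ℤ (𝓞 F))) (hu : ¬ p ∣ u) {ε y : F} (hε : ε ^ 2 = 1) :
    ε * ((p * u : ℕ) : F) ≠ y ^ 2 := by
  have hpZ : Prime (p : ℤ) := Nat.prime_iff_prime_int.1 hp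
  let 𝔭 : Ideal ℤ := Ideal.span {(p : ℤ)}
  have h𝔭 : 𝔭.IsPrime := (Ideal.span_singleton_prime hpZ.ne_zero).2 hpZ
  have h𝔭0 : 𝔭 ≠ ⊥ := by simpa [𝔭] using hp.ne_zero
  have h𝔭m : 𝔭.IsMaximal := h𝔭.isMaximal h𝔭0
  obtain ⟨P, hPm, hPl⟩ := Ideal.exists_maximal_ideal_liesOver_of_isIntegral 𝔭 (S := 𝓞 F)
  have hmem : ∀ n : ℤ, (n : 𝓞 F) ∈ P ↔ (p : ℤ) ∣ n := fun n => by
    have : n ∈ 𝔭 ↔ n ∈ P.under ℤ := by rw [← Ideal.LiesOver.over (p := 𝔭) (P := P)]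
    rw [Ideal.mem_span_singleton] at this
    rw [this, Ideal.mem_comap]; simp
  have hpP : (p : 𝓞 F) ∈ P := by simpa using (hmem p).2 dvd_rfl
  have hP0 : P ≠ ⊥ := by
    rintro rfl
    have : (p : 𝓞 F) = 0 := by simpa using hpP
    exact hp.ne_zero (by exact_mod_cast this)
  let v : HeightOneSpectrum (𝓞 F) := ⟨P, hPm.isPrime, hP0⟩
  have hsep : (p : 𝓞 F) ∉ P ^ 2 := by
    intro h2
    have h3 : P ^ 2 ∣ 𝔭.map (algebraMap ℤ (𝓞 F)) := by
      rw [Ideal.dvd_iff_le, Ideal.map_span, Set.image_singleton, Ideal.span_singleton_le_iff_mem]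
      simpa using h2
    have h4 := pow_sub_one_dvd_differentIdeal ℤ P 2 h𝔭0 h3
    have h5 : P.absNorm ∣ Ideal.absNorm (differentIdeal ℤ (𝓞 F)) := by
      refine map_dvd Ideal.absNorm ?_
      simpa using h4
    refine hd (dvd_trans ?_ h5)
    have h6 := Ideal.absNorm_mem P
    have h7 := (hmem (P.absNorm : ℤ)).1 (by simpa using h6)
    exact_mod_cast h7
  have v1 : v.valuation F (p : F) ≤ exp (-1 : ℤ) := by
    have := (v.intValuation_le_pow_iff_mem (p : 𝓞 F) 1).2 (by simpa [v] using hpP)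
    rw [← v.valuation_of_algebraMap (K := F)] at this
    simpa using this
  have v2 : ¬ v.valuation F (p : F) ≤ exp (-2 : ℤ) := by
    intro h
    refine hsep ((v.intValuation_le_pow_iff_mem (p : 𝓞 F) 2).1 ?_)
    rw [← v.valuation_of_algebraMap (K := F)]
    simpa using h
  have vu : v.valuation F (u : F) = 1 := by
    have : (u : 𝓞 F) ∉ P := fun h => hu (by
      have := (hmem u).1 (by simpa using h)
      exact_mod_cast this)
    have := (v.valuation_eq_one_iff_notMem (K := F) (r := (u : 𝓞 F))).2 this
    simpa using this
  have vε : v.valuation F ε = 1 := Valuation.map_eq_one_of_sq_eq_one hε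
  intro h
  have h' := congrArg (v.valuation F) h
  rw [map_mul, vε, one_mul, Nat.cast_mul, map_mul, vu, mul_one, map_pow] at h'
  rw [h'] at v1 v2
  by_cases hy : v.valuation F y = 0
  · rw [hy] at v2; simp at v2
  obtain ⟨m, hm⟩ : ∃ m : ℤ, v.valuation F y = exp m := ⟨log (v.valuation F y), (exp_log hy).symm⟩
  rw [hm, ← exp_nsmul, exp_le_exp] at v1 v2
  simp at v1 v2
  omega

lemma NumberField.exists_natCast_ne_sq (F : Type*) [Field F] [NumberField F] :
    ∃ n : ℕ, ∀ ε y : F, ε ^ 2 = 1 → ε * (n : F) ≠ y ^ 2 ∧ ε * ((n + 1 : ℕ) : F) ≠ y ^ 2 ∧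
      ε * ((n * (n + 1) : ℕ) : F) ≠ y ^ 2 := by
  set d := Ideal.absNorm (differentIdeal ℤ (𝓞 F)) with hd
  have hd0 : d ≠ 0 := by
    rw [hd, Ne, Ideal.absNorm_eq_zero_iff]; exact differentIdeal_ne_bot
  obtain ⟨p, hpd, hp⟩ := Nat.exists_infinite_primes (d + 1)
  obtain ⟨q, hqp, hq⟩ := Nat.exists_infinite_primes (p + 1)
  have hpd' : ¬ p ∣ d := fun h => by have := Nat.le_of_dvd (Nat.pos_of_ne_zero hd0) h; omega
  have hqd' : ¬ q ∣ d := fun h => by have := Nat.le_of_dvd (Nat.pos_of_ne_zero hd0) h; omega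
  have hco : Nat.Coprime (p ^ 2) (q ^ 2) :=
    Nat.Coprime.pow 2 2 ((Nat.coprime_primes hp hq).2 (by omega))
  obtain ⟨n, hn1, hn2⟩ := Nat.chineseRemainder hco p (q - 1)
  have aux : ∀ {r m : ℕ}, r.Prime → m ≡ r [MOD r ^ 2] → ∃ u, m = r * u ∧ ¬ r ∣ u := by
    intro r m hr h
    have h1 : r ∣ m := ((h.of_dvd (dvd_pow_self r two_ne_zero)).dvd_iff dvd_rfl).2 dvd_rfl
    obtain ⟨u, rfl⟩ := h1
    refine ⟨u, rfl, fun h2 => ?_⟩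
    have h3 : r ^ 2 ∣ r := (h.dvd_iff dvd_rfl).1 (by rw [sq]; exact Nat.mul_dvd_mul_left r h2)
    have h4 := Nat.le_of_dvd hr.pos h3
    have := hr.two_le
    nlinarith
  obtain ⟨u, hu, hpu⟩ := aux hp hn1
  obtain ⟨w, hw, hqw⟩ := aux hq (m := n + 1) (by
    have := hn2.add_right 1
    rwa [Nat.sub_add_cancel hq.pos] at this)
  refine ⟨n, fun ε y hε => ⟨?_, ?_, ?_⟩⟩
  · rw [hu]; exact NumberField.mul_natCast_ne_sq hp hpd' hpu hε
  · rw [hw]; exact NumberField.mul_natCast_ne_sq hq hqd' hqw hε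
  · have h1 : ¬ p ∣ n + 1 := fun h => by
      have h2 : p ∣ n := hu ▸ dvd_mul_right p u
      exact hp.one_lt.ne' (Nat.dvd_one.1 ((Nat.dvd_add_right h2).1 h))
    have e : n * (n + 1) = p * (u * (n + 1)) := by rw [← mul_assoc, ← hu]
    rw [e]
    exact NumberField.mul_natCast_ne_sq hp hpd' (fun h => (hp.dvd_mul.1 h).elim hpu h1) hε

end Unramified

section Detection

open IsDedekindDomain WithZero

/-- `f` lies outside the big group of some rigid pair with an exceptional element. -/
def IsDetected {L : Type*} [Field L] (f : L) : Prop :=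
  ∃ (T H : Set L) (h : L), IsRigidPair T H ∧ (∀ y : L, y ≠ 0 → y ^ 2 ∈ T) ∧
    IsRigidPair.Good T H h ∧ h ∉ T ∧ f ∉ H

lemma Valuation.isDetected {L M Γ : Type*} [Field L] [Field M] [LinearOrderedCommGroupWithZero Γ]
    (v : Valuation M Γ) (φ : L →+* M) {f h : L} (hf : φ f ∉ v.unitSq)
    (h1 : v (φ h) = 1) (h2 : v (1 + φ h) = 1) (h3 : φ h ∉ v.principalSq)
    (h4 : 1 + φ h ∉ v.principalSq) (h5 : φ h * (1 + φ h) ∉ v.principalSq) : IsDetected f := by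
  refine ⟨_, _, h, (v.comap φ).isRigidPair, fun y hy => Valuation.sq_mem_principalSq hy,
    Valuation.good (by simpa using h1) (by simpa using h2) (Valuation.comap_principalSq φ ?_)
    (Valuation.comap_principalSq φ ?_), Valuation.comap_principalSq φ h3,
    Valuation.comap_unitSq φ hf⟩
  · simpa using h4
  · simpa using h5

lemma Valuation.notMem_unitSq_of_odd {K : Type*} [Field K] (v : Valuation K ℤᵐ⁰) {x : K} {m : ℤ}
    (hx : v x = exp m) (hm : Odd m) : x ∉ v.unitSq := by
  rintro ⟨y, hy⟩
  have hy0 : v y ≠ 0 := by intro h0; rw [map_mul, map_pow, h0] at hy; simp at hy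
  rw [map_mul, map_pow, hx, ← exp_log hy0, ← exp_nsmul, ← exp_add, ← exp_zero, exp_inj] at hy
  obtain ⟨r, rfl⟩ := hm
  simp at hy
  omega

/-- If a sign times `x` times a square is a principal unit, then `x` is a sign times a square
modulo the prime. -/
lemma IsDedekindDomain.HeightOneSpectrum.exists_of_mem_principalSq {R K : Type*} [CommRing R]
    [IsDedekindDomain R] [Field K] [Algebra R K] [IsFractionRing R K] (v : HeightOneSpectrum R)
    {x : R} (hx0 : x ∉ v.asIdeal) (hx : algebraMap R K x ∈ (v.valuation K).principalSq) :
    ∃ ε a b : R, ε ^ 2 = 1 ∧ a ∉ v.asIdeal ∧ ε * x * a ^ 2 - b ^ 2 ∈ v.asIdeal := by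
  obtain ⟨ε, y, hε, h⟩ := hx
  obtain ⟨ε', rfl, hε'⟩ : ∃ ε' : R, algebraMap R K ε' = ε ∧ ε' ^ 2 = 1 := by
    rcases (show ε = 1 ∨ ε = -1 by rwa [← sq_eq_sq_iff_eq_or_eq_neg, one_pow]) with rfl | rfl
    · exact ⟨1, by simp, by simp⟩
    · exact ⟨-1, by simp, by simp⟩
  have h1 := Valuation.eq_one_of_sub_one_lt h
  have hvx : v.valuation K (algebraMap R K x) = 1 := v.valuation_eq_one_iff_notMem.2 hx0
  have hy : v.valuation K y = 1 := by
    rw [map_mul, map_mul, hvx, Valuation.map_eq_one_of_sq_eq_one hε, map_pow] at h1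
    simpa using h1
  obtain ⟨a, b, hab⟩ := v.exists_primeCompl_mul_eq_of_integer y hy.le
  have hb : (b : R) ∉ v.asIdeal := b.2
  have hvb : v.valuation K (algebraMap R K b) = 1 := v.valuation_eq_one_iff_notMem.2 hb
  have hva : v.valuation K (algebraMap R K a) = 1 := by rw [← hab, map_mul, hy, hvb, one_mul]
  refine ⟨ε', a, b, hε', v.valuation_eq_one_iff_notMem.1 hva, ?_⟩
  rw [← v.valuation_lt_one_iff_mem (K := K)]
  have e : algebraMap R K (ε' * x * a ^ 2 - (b : R) ^ 2) =
      (algebraMap R K ε' * algebraMap R K x * y ^ 2 - 1) * algebraMap R K b ^ 2 := by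
    rw [map_sub, map_mul, map_mul, map_pow, map_pow, ← hab]; ring
  change v.valuation K (algebraMap R K _) < 1
  rw [e, map_mul, map_pow, hvb, one_pow, mul_one]
  exact h

open Polynomial in
/-- A nonzero polynomial over a field is a constant times a square, or it has odd order at some
irreducible polynomial. -/
lemma Polynomial.eq_C_mul_sq_or_exists_odd {E : Type*} [Field E] (P : E[X]) (hP : P ≠ 0) :
    (∃ (c : E) (g : E[X]), c ≠ 0 ∧ P = Polynomial.C c * g ^ 2) ∨
      ∃ (p : E[X]) (v : HeightOneSpectrum E[X]) (m : ℤ), Irreducible p ∧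
        v.asIdeal = Ideal.span {p} ∧ Odd m ∧ v.intValuation P = exp m := by
  induction hn : P.natDegree using Nat.strong_induction_on generalizing P with
  | _ n ih =>
  by_cases hu : IsUnit P
  · obtain ⟨c, hc, rfl⟩ := Polynomial.isUnit_iff.1 hu
    exact Or.inl ⟨c, 1, hc.ne_zero, by simp⟩
  obtain ⟨p, hp, Q, rfl⟩ := WfDvdMonoid.exists_irreducible_factor hu hP
  let v : HeightOneSpectrum E[X] := ⟨Ideal.span {p}, (Ideal.span_singleton_prime hp.ne_zero).2
    hp.prime, by simpa using hp.ne_zero⟩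
  have hv : v.asIdeal = Ideal.span {p} := rfl
  have hvp : v.intValuation p = exp (-1 : ℤ) := v.intValuation_singleton hp.ne_zero hv
  by_cases hpQ : p ∣ Q
  · obtain ⟨Q, rfl⟩ := hpQ
    have hQ : Q ≠ 0 := by rintro rfl; simp at hP
    have hdeg : Q.natDegree < n := by
      rw [← hn, Polynomial.natDegree_mul hp.ne_zero (mul_ne_zero hp.ne_zero hQ),
        Polynomial.natDegree_mul hp.ne_zero hQ]
      have := hp.natDegree_pos
      omega
    rcases ih _ hdeg Q hQ rfl with ⟨c, g, hc, rfl⟩ | ⟨p', v', m, hp', hv', hm, hvm⟩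
    · exact Or.inl ⟨c, p * g, hc, by ring⟩
    · refine Or.inr ⟨p', v', m + 2 * log (v'.intValuation p), hp', hv', ?_, ?_⟩
      · exact hm.add_even (even_two_mul _)
      · have h0 : v'.intValuation p ≠ 0 := v'.intValuation_ne_zero _ hp.ne_zero
        rw [← mul_assoc, map_mul, map_mul, hvm, exp_add, two_mul, exp_add, exp_log h0, mul_comm]
  · refine Or.inr ⟨p, v, -1, hp, hv, by decide, ?_⟩
    have hQ : Q ∉ v.asIdeal := by rwa [hv, Ideal.mem_span_singleton]
    rw [map_mul, hvp, (v.intValuation_eq_one_iff).2 hQ, mul_one]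

open Polynomial in
/-- Every nonzero rational function over a number field that is not a constant times a square is
detected, also after pulling back along an embedding. -/
lemma RatFunc.eq_C_mul_sq_or_isDetected {E L : Type*} [Field E] [NumberField E] [Field L]
    (φ : L →+* RatFunc E) {f : L} (hf : f ≠ 0) :
    (∃ (c : E) (g : RatFunc E), c ≠ 0 ∧ φ f = RatFunc.C c * g ^ 2) ∨ IsDetected f := by
  have hφ : φ f ≠ 0 := (map_ne_zero φ).2 hf
  have hn : (φ f).num ≠ 0 := RatFunc.num_ne_zero hφ
  have hd : (φ f).denom ≠ 0 := RatFunc.denom_ne_zero _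
  have hd' : algebraMap E[X] (RatFunc E) (φ f).denom ≠ 0 := RatFunc.algebraMap_ne_zero hd
  have hF : φ f * algebraMap E[X] (RatFunc E) (φ f).denom ^ 2 =
      algebraMap E[X] (RatFunc E) ((φ f).num * (φ f).denom) := by
    have := RatFunc.num_div_denom (φ f)
    rw [div_eq_iff hd'] at this
    rw [map_mul, this]
    ring
  rcases Polynomial.eq_C_mul_sq_or_exists_odd _ (mul_ne_zero hn hd) with
    ⟨c, g, hc, h⟩ | ⟨p, v, m, hp, hv, hm, hvm⟩
  · refine Or.inl ⟨c, algebraMap E[X] (RatFunc E) g / algebraMap E[X] (RatFunc E) (φ f).denom,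
      hc, ?_⟩
    rw [h, map_mul, map_pow, RatFunc.algebraMap_C] at hF
    field_simp
    exact hF
  · right
    have hirr : Fact (Irreducible p) := ⟨hp⟩
    have : Module.Finite E (AdjoinRoot p) := (AdjoinRoot.powerBasis hp.ne_zero).finite
    have : NumberField (AdjoinRoot p) := NumberField.of_module_finite E (AdjoinRoot p)
    obtain ⟨n, hnE⟩ := NumberField.exists_natCast_ne_sq (AdjoinRoot p)
    have key : ∀ u : ℕ, (∀ ε y : AdjoinRoot p, ε ^ 2 = 1 → ε * (u : AdjoinRoot p) ≠ y ^ 2) →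
        (u : E[X]) ∉ v.asIdeal ∧ (u : RatFunc E) ∉ (v.valuation (RatFunc E)).principalSq := by
      intro u hu
      have hmem : ∀ q : E[X], q ∈ v.asIdeal ↔ AdjoinRoot.mk p q = 0 := fun q => by
        rw [hv, Ideal.mem_span_singleton, AdjoinRoot.mk_eq_zero]
      have h1 : (u : E[X]) ∉ v.asIdeal := fun h => by
        rw [hmem, map_natCast] at h
        exact hu 1 0 (by simp) (by simp [h])
      refine ⟨h1, fun h => ?_⟩
      obtain ⟨ε, a, b, hε, ha, hab⟩ := v.exists_of_mem_principalSq (K := RatFunc E) (x := (u : E[X]))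
        h1 (by simpa using h)
      rw [hmem] at ha hab
      refine hu (AdjoinRoot.mk p ε) (AdjoinRoot.mk p b / AdjoinRoot.mk p a)
        (by rw [← map_pow, hε, map_one]) ?_
      rw [map_sub, map_mul, map_mul, map_pow, map_pow, map_natCast, sub_eq_zero] at hab
      rw [div_pow, eq_div_iff (pow_ne_zero 2 ha)]
      exact hab
    have h1 := key n fun ε y h => (hnE ε y h).1
    have h2 := key (n + 1) fun ε y h => (hnE ε y h).2.1
    have h3 := key (n * (n + 1)) fun ε y h => (hnE ε y h).2.2
    have val : ∀ u : ℕ, (u : E[X]) ∉ v.asIdeal → v.valuation (RatFunc E) (u : RatFunc E) = 1 :=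
      fun u hu => by
        have := (v.valuation_eq_one_iff_notMem (K := RatFunc E)).2 hu
        simpa using this
    refine (v.valuation (RatFunc E)).isDetected φ (h := (n : L)) ?_ ?_ ?_ ?_ ?_ ?_
    · rintro ⟨y, hy⟩
      refine (v.valuation (RatFunc E)).notMem_unitSq_of_odd
        (by rw [HeightOneSpectrum.valuation_of_algebraMap]; exact hvm) hm
        ⟨y / algebraMap E[X] (RatFunc E) (φ f).denom, ?_⟩
      change v.valuation (RatFunc E) (algebraMap E[X] (RatFunc E) _ * _) = 1
      rw [← hF, div_pow, mul_assoc, mul_div_cancel₀ _ (pow_ne_zero 2 hd')]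
      exact hy
    · simpa using val n h1.1
    · simpa [add_comm] using val (n + 1) h2.1
    · simpa using h1.2
    · simpa [add_comm] using h2.2
    · simpa [add_comm] using h3.2

end Detection

section Descent

open IntermediateField

variable {l : Type*} [Field l]

lemma eq_zero_of_add_mul_eq_zero {Ω : Type*} [Field Ω] [Algebra l Ω] {a : l} {s : Ω}
    (hs : s ^ 2 = algebraMap l Ω a) (ha : ¬ IsSquare a) {c₀ c₁ : l}
    (h : algebraMap l Ω c₀ + algebraMap l Ω c₁ * s = 0) : c₀ = 0 ∧ c₁ = 0 := by
  by_cases hc : c₁ = 0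
  · subst hc
    simpa using h
  refine absurd ⟨-c₀ / c₁, ?_⟩ ha
  apply (algebraMap l Ω).injective
  have hc' : algebraMap l Ω c₁ ≠ 0 := (map_ne_zero _).2 hc
  have e : s = -algebraMap l Ω c₀ / algebraMap l Ω c₁ := by
    rw [eq_div_iff hc']; linear_combination h
  rw [← hs, map_mul, map_div₀, map_neg, ← e, sq]

/-- The conjugation of a quadratic extension. -/
lemma exists_conj {Ω : Type*} [Field Ω] [Algebra l Ω] {a : l} {s : Ω}
    (hs : s ^ 2 = algebraMap l Ω a) (ha : ¬ IsSquare a)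
    (hE : ∀ e : Ω, ∃ c₀ c₁ : l, e = algebraMap l Ω c₀ + algebraMap l Ω c₁ * s) :
    ∃ τ : Ω →+* Ω, τ s = -s ∧ ∀ c : l, τ (algebraMap l Ω c) = algebraMap l Ω c := by
  choose f g hfg using hE
  have uniq : ∀ c d c' d' : l, algebraMap l Ω c + algebraMap l Ω d * s =
      algebraMap l Ω c' + algebraMap l Ω d' * s → c = c' ∧ d = d' := by
    intro c d c' d' h
    have := eq_zero_of_add_mul_eq_zero hs ha (c₀ := c - c') (c₁ := d - d')
      (by simp only [map_sub]; linear_combination h)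
    exact ⟨sub_eq_zero.1 this.1, sub_eq_zero.1 this.2⟩
  have val : ∀ (e : Ω) (c d : l), e = algebraMap l Ω c + algebraMap l Ω d * s →
      f e = c ∧ g e = d := fun e c d h => uniq _ _ _ _ ((hfg e).symm.trans h)
  have hτ : ∀ (e : Ω) (c d : l), e = algebraMap l Ω c + algebraMap l Ω d * s →
      algebraMap l Ω (f e) - algebraMap l Ω (g e) * s =
      algebraMap l Ω c - algebraMap l Ω d * s := fun e c d h => by
    rw [(val e c d h).1, (val e c d h).2]
  refine ⟨⟨⟨⟨fun e => algebraMap l Ω (f e) - algebraMap l Ω (g e) * s, ?_⟩, ?_⟩, ?_, ?_⟩, ?_, ?_⟩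
  · simpa using hτ 1 1 0 (by simp)
  · intro u w
    have := hτ (u * w) (f u * f w + a * g u * g w) (f u * g w + g u * f w) (by
      conv_lhs => rw [hfg u, hfg w]
      simp only [map_add, map_mul, ← hs]; ring)
    simp only [this, map_add, map_mul, ← hs]; ring
  · simpa using hτ 0 0 0 (by simp)
  · intro u w
    have := hτ (u + w) (f u + f w) (g u + g w) (by
      conv_lhs => rw [hfg u, hfg w]
      simp only [map_add]; ring)
    simp only [this, map_add]; ring
  · simpa using hτ s 0 1 (by simp)
  · intro c
    simpa using hτ _ c 0 (by simp)

lemma RatFunc.eq_C_of_isAlgebraic {E : Type*} [Field E] {f : RatFunc E} (h : IsAlgebraic E f) :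
    ∃ c, f = RatFunc.C c := by
  by_contra hc
  exact f.transcendental_of_ne_C hc h

/-- Substitution of a nonconstant rational function, twisted by an endomorphism of the constants. -/
lemma RatFunc.exists_ringHom {E : Type*} [Field E] (τ : E →+* E) (z : RatFunc E)
    (hz : ¬ ∃ c, z = RatFunc.C c) :
    ∃ σ : RatFunc E →+* RatFunc E, σ RatFunc.X = z ∧ ∀ c, σ (RatFunc.C c) = RatFunc.C (τ c) := by
  let ψ : Polynomial E →+* RatFunc E := Polynomial.eval₂RingHom (RatFunc.C.comp τ) z
  have hψ : Function.Injective ψ := by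
    rw [injective_iff_map_eq_zero]
    intro p hp
    have h1 : Polynomial.aeval z (p.map τ) = 0 := by
      rw [Polynomial.aeval_def, Polynomial.eval₂_map]
      exact hp
    by_contra hp0
    exact z.transcendental_of_ne_C hz ⟨p.map τ, (Polynomial.map_ne_zero_iff τ.injective).2 hp0, h1⟩
  have hψ' : nonZeroDivisors (Polynomial E) ≤ (nonZeroDivisors (RatFunc E)).comap ψ :=
    nonZeroDivisors_le_comap_nonZeroDivisors_of_injective ψ hψ
  refine ⟨RatFunc.liftRingHom ψ hψ', ?_, fun c => ?_⟩
  · rw [← RatFunc.algebraMap_X, RatFunc.liftRingHom_algebraMap]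
    simp [ψ]
  · rw [← RatFunc.algebraMap_C, RatFunc.liftRingHom_algebraMap]
    simp [ψ]

lemma RatFunc.C_div_X_ne_C {E : Type*} [Field E] {b : E} (hb : b ≠ 0) :
    ¬ ∃ c, RatFunc.C b / (RatFunc.X : RatFunc E) = RatFunc.C c := by
  rintro ⟨c, hc⟩
  rw [div_eq_iff RatFunc.X_ne_zero, ← RatFunc.algebraMap_C, ← RatFunc.algebraMap_C,
    ← RatFunc.algebraMap_X, ← map_mul] at hc
  have := RatFunc.algebraMap_injective E hc
  have := congrArg (fun p => Polynomial.coeff p 0) this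
  simp at this
  exact hb this

/-- The rational function field is generated over `L` by the adjoined square root. -/
lemma RatFunc.exists_eq_add_mul {E L : Type*} [Field E] [Field L] [CharZero E] [Algebra l E]
    [Algebra l L] {a b : l} {s : E} (hs : s ^ 2 = algebraMap l E a)
    (hE : ∀ e : E, ∃ c₀ c₁ : l, e = algebraMap l E c₀ + algebraMap l E c₁ * s)
    (φ : L →+* RatFunc E) (hφ : ∀ c : l, φ (algebraMap l L c) = RatFunc.C (algebraMap l E c))
    {u v : L} (hu : φ u = RatFunc.X + RatFunc.C (algebraMap l E b) / RatFunc.X)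
    (hv : RatFunc.C s * φ v = RatFunc.X - RatFunc.C (algebraMap l E b) / RatFunc.X)
    (g : RatFunc E) : ∃ u v : L, g = φ u + φ v * RatFunc.C s := by
  let _ := φ.toAlgebra
  have hs' : RatFunc.C s ^ 2 = algebraMap L (RatFunc E) (algebraMap l L a) := by
    rw [RingHom.algebraMap_toAlgebra, hφ, ← map_pow, hs]
  refine exists_eq_add_mul_of_mem_adjoin hs' ?_
  have hsm : RatFunc.C s ∈ L⟮RatFunc.C s⟯ := mem_adjoin_simple_self L _
  have hφm : ∀ w : L, φ w ∈ L⟮RatFunc.C s⟯ := fun w => IntermediateField.algebraMap_mem _ w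
  have hC : ∀ e : E, RatFunc.C e ∈ L⟮RatFunc.C s⟯ := fun e => by
    obtain ⟨c₀, c₁, rfl⟩ := hE e
    rw [map_add, map_mul, ← hφ, ← hφ]
    exact add_mem (hφm _) (mul_mem (hφm _) hsm)
  have hX : RatFunc.X ∈ L⟮RatFunc.C s⟯ := by
    have e : (RatFunc.X : RatFunc E) = (φ u + RatFunc.C s * φ v) * RatFunc.C 2⁻¹ := by
      rw [hu, hv, map_inv₀, map_ofNat]
      have : (2 : RatFunc E) ≠ 0 := by simp
      have hX := RatFunc.X_ne_zero (K := E)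
      field_simp
      ring
    rw [e]
    exact mul_mem (add_mem (hφm _) (mul_mem hsm (hφm _))) (hC _)
  have hP : ∀ p : Polynomial E, algebraMap (Polynomial E) (RatFunc E) p ∈ L⟮RatFunc.C s⟯ := by
    intro p
    induction p using Polynomial.induction_on' with
    | add p q hp hq => rw [map_add]; exact add_mem hp hq
    | monomial n c =>
      rw [← Polynomial.C_mul_X_pow_eq_monomial, map_mul, map_pow, RatFunc.algebraMap_C,
        RatFunc.algebraMap_X]
      exact mul_mem (hC c) (pow_mem hX n)
  rw [← RatFunc.num_div_denom g]
  exact div_mem (hP _) (hP _)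

/-- In a conic function field, an element that becomes a constant times a square over the splitting
quadratic extension is already a constant times a square. -/
lemma RatFunc.exists_eq_algebraMap_mul_sq {E L : Type*} [Field E] [Field L] [CharZero E]
    [Algebra l E] [Algebra l L] {a b : l} (ha : a ≠ 0) (hb : b ≠ 0) {s : E}
    (hs : s ^ 2 = algebraMap l E a)
    (hE : ∀ e : E, ∃ c₀ c₁ : l, e = algebraMap l E c₀ + algebraMap l E c₁ * s)
    (φ : L →+* RatFunc E) (hφ : ∀ c : l, φ (algebraMap l L c) = RatFunc.C (algebraMap l E c))
    {x y : L} (hxy : IntermediateField.adjoin l {x, y} = ⊤) (hy : y ≠ 0)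
    (hu : φ (2 / y) = RatFunc.X + RatFunc.C (algebraMap l E b) / RatFunc.X)
    (hv : RatFunc.C s * φ (2 * x / y) = RatFunc.X - RatFunc.C (algebraMap l E b) / RatFunc.X)
    {f : L} (hf : f ≠ 0) {c : E} {g : RatFunc E} (hc : c ≠ 0) (hfg : φ f = RatFunc.C c * g ^ 2) :
    ∃ (c' : l) (g' : L), c' ≠ 0 ∧ f = algebraMap l L c' * g' ^ 2 := by
  have hdec := RatFunc.exists_eq_add_mul hs hE φ hφ hu hv
  have hφinj := φ.injective
  obtain ⟨u, v, rfl⟩ := hdec g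
  by_cases hsq : IsSquare a
  · obtain ⟨r, rfl⟩ := hsq
    obtain ⟨r', rfl⟩ : ∃ r', s = algebraMap l E r' := by
      have : (s - algebraMap l E r) * (s + algebraMap l E r) = 0 := by
        rw [map_mul] at hs; linear_combination hs
      rcases mul_eq_zero.1 this with h | h
      · exact ⟨r, sub_eq_zero.1 h⟩
      · exact ⟨-r, by rw [map_neg]; linear_combination h⟩
    obtain ⟨c₀, c₁, rfl⟩ := hE c
    refine ⟨c₀ + c₁ * r', u + v * algebraMap l L r', ?_, hφinj ?_⟩
    · rintro h
      rw [← map_mul, ← map_add, h, map_zero] at hc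
      exact hc rfl
    · rw [hfg]
      simp [hφ]
  have h2 : (2 : E) ≠ 0 := two_ne_zero
  have hs0 : s ≠ 0 := by
    rintro rfl
    exact ha ((map_eq_zero (algebraMap l E)).1 (by rw [← hs]; ring))
  have hbE : algebraMap l E b ≠ 0 := (map_ne_zero _).2 hb
  have hX := RatFunc.X_ne_zero (K := E)
  have hCb : RatFunc.C (algebraMap l E b) ≠ 0 := (map_ne_zero _).2 hbE
  have hCs : RatFunc.C s ≠ 0 := (map_ne_zero _).2 hs0
  obtain ⟨τ, hτs, hτ⟩ := exists_conj hs hsq hE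
  obtain ⟨σ, hσX, hσC⟩ := RatFunc.exists_ringHom τ _ (RatFunc.C_div_X_ne_C hbE)
  have hσs : σ (RatFunc.C s) = -RatFunc.C s := by rw [hσC, hτs, map_neg]
  have hσl : ∀ d : l, σ (φ (algebraMap l L d)) = φ (algebraMap l L d) := fun d => by
    rw [hφ, hσC, hτ]
  have hσu : σ (φ (2 / y)) = φ (2 / y) := by
    rw [hu, map_add, map_div₀, hσX, hσC, hτ]
    field_simp
    ring
  have hσv : σ (φ (2 * x / y)) = φ (2 * x / y) := by
    refine mul_left_cancel₀ (neg_ne_zero.2 hCs) ?_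
    conv_lhs => rw [← hσs, ← map_mul, hv, map_sub, map_div₀, hσX, hσC, hτ]
    rw [neg_mul, hv]
    field_simp
    ring
  have h2L : (2 : L) ≠ 0 := fun h => by
    have := congrArg φ h
    rw [map_ofNat, map_zero] at this
    exact (map_ne_zero (RatFunc.C (K := E))).2 h2 (by simp at this)
  have hσy : σ (φ y) = φ y := by
    have e : y = 2 * (2 / y)⁻¹ := by field_simp
    rw [e, map_mul, map_mul, map_inv₀, map_inv₀, hσu, map_ofNat, map_ofNat]
  have hσx : σ (φ x) = φ x := by
    have e : x = (2 * x / y) * (2 / y)⁻¹ := by field_simp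
    rw [e, map_mul, map_mul, map_inv₀, map_inv₀, hσu, hσv]
  have hσφ : ∀ z : L, σ (φ z) = φ z := by
    intro z
    have hz : z ∈ IntermediateField.adjoin l {x, y} := by rw [hxy]; trivial
    induction hz using IntermediateField.adjoin_induction with
    | mem z hz =>
      rcases hz with rfl | hz
      · exact hσx
      · rw [Set.mem_singleton_iff.1 hz]; exact hσy
    | algebraMap d => exact hσl d
    | add z w _ _ hz hw => rw [map_add, map_add, hz, hw]
    | inv z _ hz => rw [map_inv₀, map_inv₀, hz]
    | mul z w _ _ hz hw => rw [map_mul, map_mul, hz, hw]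
  have hCs2 : RatFunc.C s ^ 2 = φ (algebraMap l L a) := by rw [hφ, ← map_pow, hs]
  have hσg : ∀ z w : L, σ (φ z + φ w * RatFunc.C s) = φ z - φ w * RatFunc.C s := fun z w => by
    rw [map_add, map_mul, hσφ, hσφ, hσs]; ring
  have hfix : ∀ e : E, τ e = e → ∃ e' : l, e = algebraMap l E e' := by
    intro e he
    obtain ⟨c₀, c₁, rfl⟩ := hE e
    refine ⟨c₀, ?_⟩
    rw [map_add, map_mul, hτs, hτ, hτ] at he
    have : 2 * (algebraMap l E c₁ * s) = 0 := by linear_combination -he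
    rcases mul_eq_zero.1 this with h | h
    · exact absurd h h2
    · rw [h, add_zero]
  have hf0 : φ f ≠ 0 := (map_ne_zero φ).2 hf
  have hg0 : φ u + φ v * RatFunc.C s ≠ 0 := by rintro h; rw [h] at hfg; simp [hf0] at hfg
  have hσg0 : φ u - φ v * RatFunc.C s ≠ 0 := by rw [← hσg]; exact (map_ne_zero σ).2 hg0
  have hcoll : ∀ (w : E) (d : l), w ≠ 0 → c = algebraMap l E d * w ^ 2 →
      ∃ (c' : l) (g' : L), c' ≠ 0 ∧ f = algebraMap l L c' * g' ^ 2 := by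
    rintro w d hw rfl
    have hd : d ≠ 0 := by rintro rfl; simp at hc
    obtain ⟨u', v', huv⟩ := hdec (RatFunc.C w * (φ u + φ v * RatFunc.C s))
    have hfd : φ f = φ (algebraMap l L d) * (φ u' + φ v' * RatFunc.C s) ^ 2 := by
      rw [hfg, ← huv, hφ, map_mul, map_pow]; ring
    have hd0 : φ (algebraMap l L d) ≠ 0 := by simpa using hd
    have h3 := congrArg σ hfd
    rw [map_mul, map_pow, hσg, hσφ, hσφ, hfd] at h3
    have h4 : φ (4 * u' * v') = 0 := by
      have h5 := mul_left_cancel₀ hd0 h3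
      refine mul_right_cancel₀ hCs ?_
      rw [map_mul, map_mul, map_ofNat, zero_mul]
      linear_combination h5
    have h5 : 4 * u' * v' = 0 := (map_eq_zero φ).1 h4
    have h6 : u' = 0 ∨ v' = 0 := by
      have : (4 : L) ≠ 0 := by
        have : (4 : L) = 2 * 2 := by norm_num
        rw [this]; exact mul_ne_zero h2L h2L
      rcases mul_eq_zero.1 h5 with h | h
      · exact Or.inl ((mul_eq_zero.1 h).resolve_left this)
      · exact Or.inr h
    rcases h6 with rfl | rfl
    · refine ⟨d * a, v', mul_ne_zero hd ha, hφinj ?_⟩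
      rw [hfd, map_zero, zero_add, mul_pow, hCs2]
      simp only [map_mul, map_pow]; ring
    · refine ⟨d, u', hd, hφinj ?_⟩
      rw [hfd]
      simp only [map_mul, map_pow, map_zero]; ring
  set n : L := u ^ 2 - algebraMap l L a * v ^ 2 with hn
  have hφn : φ n = (φ u + φ v * RatFunc.C s) * (φ u - φ v * RatFunc.C s) := by
    rw [hn, map_sub, map_mul, map_pow, map_pow, ← hCs2]; ring
  have hn0 : φ n ≠ 0 := by rw [hφn]; exact mul_ne_zero hg0 hσg0
  have hfσ : φ f = RatFunc.C (τ c) * (φ u - φ v * RatFunc.C s) ^ 2 := by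
    have := congrArg σ hfg
    rwa [hσφ, map_mul, map_pow, hσg, hσC] at this
  have hM2 : φ (f / n) ^ 2 = RatFunc.C (c * τ c) := by
    rw [map_div₀, div_pow, div_eq_iff (pow_ne_zero 2 hn0), hφn, map_mul, sq (φ f)]
    nth_rewrite 1 [hfg]
    rw [hfσ]
    ring
  obtain ⟨m, hm⟩ := RatFunc.eq_C_of_isAlgebraic (f := φ (f / n)) (by
    refine IsAlgebraic.of_pow two_pos ?_
    rw [hM2, ← RatFunc.algebraMap_eq_C]
    exact isAlgebraic_algebraMap _)
  have hCinj := (RatFunc.C (K := E)).injective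
  have hm2 : m ^ 2 = c * τ c := hCinj (by rw [map_pow, ← hm, hM2])
  have hτm : τ m = m := hCinj (by rw [← hσC, ← hm, hσφ])
  obtain ⟨m', rfl⟩ := hfix m hτm
  by_cases hw : c + algebraMap l E m' = 0
  · exact hcoll 1 (-m') one_ne_zero (by rw [map_neg]; linear_combination hw)
  · have hτw : τ (c + algebraMap l E m') ≠ 0 := (map_ne_zero τ).2 hw
    obtain ⟨n', hn'⟩ := hfix ((c + algebraMap l E m') * τ (c + algebraMap l E m')) (by
      obtain ⟨c₀, c₁, rfl⟩ := hE c
      simp only [map_add, map_mul, hτs, hτ, map_neg]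
      ring)
    refine hcoll (c + algebraMap l E m') (m' / n') hw ?_
    rw [map_div₀, ← hn']
    field_simp
    rw [map_add, hτ]
    linear_combination -hm2

lemma IsConicGen.eq_algebraMap_mul_sq_or_isDetected [NumberField l] {L : Type*} [Field L]
    [Algebra l L] {a b : l} (ha : a ≠ 0) (hb : b ≠ 0) {x y : L} (h : IsConicGen l a b x y)
    (hna : ¬ Algebra.IsAlgebraic l L) {f : L} (hf : f ≠ 0) :
    (∃ (c : l) (g : L), c ≠ 0 ∧ f = algebraMap l L c * g ^ 2) ∨ IsDetected f := by
  obtain ⟨E, s, φ, hs, hE, hφ, -, hu, hv⟩ := h.exists_embedding ha hb hna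
  classical
  have : Module.Finite l E := ⟨⟨({1, s} : Finset E), by
    refine top_unique fun e _ => ?_
    obtain ⟨c₀, c₁, he⟩ := hE e
    rw [Finset.coe_insert, Finset.coe_singleton, Submodule.mem_span_pair]
    exact ⟨c₀, c₁, by rw [he, Algebra.smul_def, Algebra.smul_def, mul_one]⟩⟩⟩
  have : NumberField E := NumberField.of_module_finite l E
  rcases RatFunc.eq_C_mul_sq_or_isDetected φ hf with ⟨c, g, hc, hg⟩ | h'
  · exact Or.inl (RatFunc.exists_eq_algebraMap_mul_sq ha hb hs hE φ hφ h.adjoin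
      (h.ne_zero ha hna) hu hv hf hc hg)
  · exact Or.inr h'

end Descent

section IdealSquare

open scoped nonZeroDivisors
open IsDedekindDomain WithZero FractionalIdeal

variable {R F : Type*} [CommRing R] [IsDedekindDomain R] [Field F] [Algebra R F]
  [IsFractionRing R F]

lemma FractionalIdeal.valuation_eq_exp_neg_count (v : HeightOneSpectrum R) {c : F} (hc : c ≠ 0) :
    v.valuation F c = exp (-count F v (spanSingleton R⁰ c)) := by
  classical
  obtain ⟨n, d, rfl⟩ := IsLocalization.exists_mk'_eq R⁰ c
  have hd : (d : R) ≠ 0 := nonZeroDivisors.coe_ne_zero d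
  have hn : n ≠ 0 := by
    rintro rfl
    exact hc (IsLocalization.mk'_zero _)
  rw [v.valuation_of_mk', v.intValuation_if_neg hn, v.intValuation_if_neg hd,
    count_well_defined F v (a := (d : R)) (J := Ideal.span {n})
      (by rwa [Ne, spanSingleton_eq_zero_iff]) ?_, ← exp_sub]
  · congr 1; ring
  · rw [coeIdeal_span_singleton, spanSingleton_mul_spanSingleton, IsFractionRing.mk'_eq_div]
    congr 1
    field_simp

/-- A principal fractional ideal that is not a square has odd valuation at some prime. -/
lemma FractionalIdeal.exists_odd_valuation {c : F} (hc : c ≠ 0)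
    (h : ¬ ∃ J : FractionalIdeal R⁰ F, spanSingleton R⁰ c = J ^ 2) :
    ∃ (v : HeightOneSpectrum R) (m : ℤ), Odd m ∧ v.valuation F c = exp m := by
  by_contra hodd
  push Not at hodd
  have hc' : spanSingleton R⁰ c ≠ 0 := by rwa [Ne, spanSingleton_eq_zero_iff]
  have heven : ∀ v : HeightOneSpectrum R, ∃ m : ℤ, count F v (spanSingleton R⁰ c) = 2 * m := by
    intro v
    have h1 := hodd v _ |>.mt (not_not.2 (valuation_eq_exp_neg_count v hc))
    rw [Int.not_odd_iff_even, even_neg] at h1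
    obtain ⟨m, hm⟩ := h1
    exact ⟨m, by rw [hm]; ring⟩
  choose m hm using heven
  refine h ⟨∏ᶠ v : HeightOneSpectrum R, (v.asIdeal : FractionalIdeal R⁰ F) ^ m v, ?_⟩
  rw [finprod_pow, ← finprod_heightOneSpectrum_factorization' F hc']
  · refine finprod_congr fun v => ?_
    rw [hm, mul_comm, zpow_mul]
    norm_cast
  · refine (Filter.eventually_cofinite.1 (finite_factors (spanSingleton R⁰ c))).subset ?_
    intro v hv h0
    rw [hm] at h0
    have : m v = 0 := by omega
    rw [Function.mem_mulSupport, this, zpow_zero] at hv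
    exact hv rfl

end IdealSquare

section Reduction

open IntermediateField WithZero

variable {l L : Type*} [Field l] [Field L] [Algebra l L]

namespace IsConicGen

lemma of_mem {a b a' b' : l} {x y x' y' : L} (h : IsConicGen l a b x y)
    (heq : algebraMap l L a' * x' ^ 2 + algebraMap l L b' * y' ^ 2 = 1)
    (hx : x ∈ IntermediateField.adjoin l {x', y'}) (hy : y ∈ IntermediateField.adjoin l {x', y'}) :
    IsConicGen l a' b' x' y' where
  eq := heq
  adjoin := by
    rw [eq_top_iff, ← h.adjoin, IntermediateField.adjoin_le_iff]
    rintro z (rfl | hz)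
    · exact hx
    · rw [Set.mem_singleton_iff.1 hz]; exact hy

lemma mem_fst (x y : L) : x ∈ IntermediateField.adjoin l {x, y} :=
  IntermediateField.subset_adjoin _ _ (by simp)

lemma mem_snd (x y : L) : y ∈ IntermediateField.adjoin l {x, y} :=
  IntermediateField.subset_adjoin _ _ (by simp)

variable {a b : l} {x y : L}

lemma swap (h : IsConicGen l a b x y) : IsConicGen l b a y x :=
  h.of_mem (by rw [add_comm]; exact h.eq) (mem_snd _ _) (mem_fst _ _)

lemma mul_sq (h : IsConicGen l a b x y) {t : l} (ht : t ≠ 0) :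
    IsConicGen l (a * t ^ 2) b (x / algebraMap l L t) y := by
  have ht' : algebraMap l L t ≠ 0 := (map_ne_zero _).2 ht
  refine h.of_mem ?_ ?_ (mem_snd _ _)
  · rw [← h.eq, map_mul, map_pow]
    field_simp
  · have := mul_mem (mem_fst (l := l) (x / algebraMap l L t) y)
      (IntermediateField.algebraMap_mem _ t)
    rwa [div_mul_cancel₀ _ ht'] at this

lemma rotate (h : IsConicGen l a b x y) (hb : b ≠ 0) (hy : y ≠ 0) :
    IsConicGen l b (-(a * b)) (1 / (algebraMap l L b * y)) (x / (algebraMap l L b * y)) := by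
  have hb' : algebraMap l L b ≠ 0 := (map_ne_zero _).2 hb
  have h1 := mem_fst (l := l) (1 / (algebraMap l L b * y)) (x / (algebraMap l L b * y))
  have h2 := mem_snd (l := l) (1 / (algebraMap l L b * y)) (x / (algebraMap l L b * y))
  refine h.of_mem ?_ ?_ ?_
  · rw [map_neg, map_mul]
    field_simp
    linear_combination -h.eq
  · have := div_mem h2 h1
    convert this using 1
    field_simp
  · have := inv_mem (mul_mem (IntermediateField.algebraMap_mem _ b) h1)
    convert this using 1
    field_simp

lemma mul_one_sub (h : IsConicGen l a b x y) (ha : 1 - a ≠ 0)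
    (hx : 1 + algebraMap l L a * x ≠ 0) :
    IsConicGen l a (b * (1 - a)) ((1 + x) / (1 + algebraMap l L a * x))
      (y / (1 + algebraMap l L a * x)) := by
  have ha' : 1 - algebraMap l L a ≠ 0 := by
    rw [← map_one (algebraMap l L), ← map_sub]; exact (map_ne_zero _).2 ha
  set x' := (1 + x) / (1 + algebraMap l L a * x) with hx'
  set y' := y / (1 + algebraMap l L a * x) with hy'
  have e : algebraMap l L a * x' - 1 = -(1 - algebraMap l L a) / (1 + algebraMap l L a * x) := by
    rw [hx']; field_simp; ring
  have hmx : x ∈ IntermediateField.adjoin l {x', y'} := by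
    have := div_mem (sub_mem (one_mem _) (mem_fst (l := l) x' y'))
      (sub_mem (mul_mem (IntermediateField.algebraMap_mem _ a) (mem_fst (l := l) x' y'))
        (one_mem _))
    convert this using 1
    have e' : 1 - x' = -(x * (1 - algebraMap l L a)) / (1 + algebraMap l L a * x) := by
      rw [eq_div_iff hx, sub_mul, hx', div_mul_cancel₀ _ hx]; ring
    rw [e, e', div_div_div_cancel_right₀ hx, neg_div_neg_eq, mul_div_assoc, div_self ha', mul_one]
  refine h.of_mem ?_ hmx ?_
  · rw [hx', hy', map_mul, map_sub, map_one]
    field_simp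
    linear_combination (1 - algebraMap l L a) * h.eq
  · have := mul_mem (mem_snd (l := l) x' y') (add_mem (one_mem _)
      (mul_mem (IntermediateField.algebraMap_mem _ a) hmx))
    rwa [hy', div_mul_cancel₀ _ hx] at this

lemma add_mul_sq (h : IsConicGen l a b x y) {z : l} (hs : a + b * z ^ 2 ≠ 0) :
    ∃ x' y' : L, IsConicGen l (a + b * z ^ 2) (a * b * (a + b * z ^ 2)) x' y' := by
  have hs' : algebraMap l L a + algebraMap l L b * algebraMap l L z ^ 2 ≠ 0 := by
    rw [← map_pow, ← map_mul, ← map_add]; exact (map_ne_zero _).2 hs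
  set S := algebraMap l L a + algebraMap l L b * algebraMap l L z ^ 2 with hS
  refine ⟨(algebraMap l L a * x + algebraMap l L b * algebraMap l L z * y) / S,
    (algebraMap l L z * x - y) / S, ?_⟩
  set x' := (algebraMap l L a * x + algebraMap l L b * algebraMap l L z * y) / S with hx'
  set y' := (algebraMap l L z * x - y) / S with hy'
  have ex : x = x' + algebraMap l L b * algebraMap l L z * y' := by
    rw [hx', hy']; field_simp; rw [hS]; ring
  have ey : y = algebraMap l L z * x - S * y' := by
    rw [hy']; field_simp; ring
  have hC := fun c => IntermediateField.algebraMap_mem (IntermediateField.adjoin l {x', y'}) c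
  have hmx : x ∈ IntermediateField.adjoin l {x', y'} := by
    have := add_mem (mem_fst (l := l) x' y') (mul_mem (mul_mem (hC b) (hC z)) (mem_snd x' y'))
    rwa [← ex] at this
  refine h.of_mem ?_ hmx ?_
  · simp only [map_mul, map_add, map_pow]
    rw [← hS, hx', hy']
    field_simp
    rw [hS]
    linear_combination (algebraMap l L a + algebraMap l L b * algebraMap l L z ^ 2) * h.eq
  · have := sub_mem (mul_mem (hC z) hmx) (mul_mem (add_mem (hC a) (mul_mem (hC b)
      (pow_mem (hC z) 2))) (mem_snd x' y'))
    rwa [← hS, ← ey] at this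

lemma one_add_mul_ne_zero (h : IsConicGen l a b x y) (ha : a ≠ 0) (hb : b ≠ 0)
    (hna : ¬ Algebra.IsAlgebraic l L) : 1 + algebraMap l L a * x ≠ 0 := by
  intro h0
  have ha' : algebraMap l L a ≠ 0 := (map_ne_zero _).2 ha
  have hb' : algebraMap l L b ≠ 0 := (map_ne_zero _).2 hb
  have hx : x = algebraMap l L (-a⁻¹) := by
    rw [map_neg, map_inv₀]
    field_simp
    linear_combination h0
  have hy : y ^ 2 = algebraMap l L ((1 - a⁻¹) / b) := by
    rw [map_div₀, map_sub, map_one, map_inv₀, eq_div_iff hb']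
    have := h.eq
    rw [hx, map_neg, map_inv₀] at this
    field_simp at this ⊢
    linear_combination this
  refine h.not_isIntegral hna ⟨hx ▸ isIntegral_algebraMap, .of_pow two_pos ?_⟩
  rw [hy]
  exact isIntegral_algebraMap

end IsConicGen

variable (L) in
/-- The field `L` is the function field of the conic `a x² + b y² = 1`, where `a` and `b` are
nonzero. -/
def HasConicGen (a b : l) : Prop := a ≠ 0 ∧ b ≠ 0 ∧ ∃ x y : L, IsConicGen l a b x y

namespace HasConicGen

variable {a b : l}

lemma mul_sq (h : HasConicGen L a b) {t : l} (ht : t ≠ 0) : HasConicGen L (a * t ^ 2) b := by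
  obtain ⟨ha, hb, x, y, h⟩ := h
  exact ⟨mul_ne_zero ha (pow_ne_zero 2 ht), hb, _, _, h.mul_sq ht⟩

lemma swap (h : HasConicGen L a b) : HasConicGen L b a := by
  obtain ⟨ha, hb, x, y, h⟩ := h
  exact ⟨hb, ha, _, _, h.swap⟩

lemma rotate (h : HasConicGen L a b) (hna : ¬ Algebra.IsAlgebraic l L) :
    HasConicGen L b (-(a * b)) := by
  obtain ⟨ha, hb, x, y, h⟩ := h
  exact ⟨hb, neg_ne_zero.2 (mul_ne_zero ha hb), _, _, h.rotate hb (h.ne_zero ha hna)⟩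

lemma mul_one_sub (h : HasConicGen L a b) (hna : ¬ Algebra.IsAlgebraic l L) (h1 : 1 - a ≠ 0) :
    HasConicGen L a (b * (1 - a)) := by
  obtain ⟨ha, hb, x, y, h⟩ := h
  exact ⟨ha, mul_ne_zero hb h1, _, _, h.mul_one_sub h1 (h.one_add_mul_ne_zero ha hb hna)⟩

lemma add_mul_sq (h : HasConicGen L a b) {z : l} (hs : a + b * z ^ 2 ≠ 0) :
    HasConicGen L (a + b * z ^ 2) (a * b * (a + b * z ^ 2)) := by
  obtain ⟨ha, hb, x, y, h⟩ := h
  exact ⟨hs, mul_ne_zero (mul_ne_zero ha hb) hs, h.add_mul_sq hs⟩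

variable {v : Valuation l ℤᵐ⁰} {π : l}

lemma exists_unit (h : HasConicGen L a b) (hna : ¬ Algebra.IsAlgebraic l L)
    (hπ : v π = exp (-1)) : ∃ d c, HasConicGen L d c ∧ v d = 1 := by
  have hπ0 : π ≠ 0 := by rintro rfl; exact exp_ne_zero (by rw [← hπ, map_zero])
  have scale : ∀ {d c : l} {m : ℤ}, HasConicGen L d c → v d = exp m → Even m →
      ∃ d c, HasConicGen L d c ∧ v d = 1 := by
    rintro d c m h hd ⟨j, rfl⟩
    refine ⟨_, _, h.mul_sq (t := π ^ j) (zpow_ne_zero _ hπ0), ?_⟩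
    rw [map_mul, map_pow, map_zpow₀, hπ, hd, ← exp_zsmul, ← exp_nsmul, ← exp_add, ← exp_zero]
    congr 1
    simp
    ring
  have hva : v a = exp (log (v a)) := (exp_log (by simpa using h.1)).symm
  have hvb : v b = exp (log (v b)) := (exp_log (by simpa using h.2.1)).symm
  by_cases h1 : Even (log (v a))
  · exact scale h hva h1
  by_cases h2 : Even (log (v b))
  · exact scale h.swap hvb h2
  · refine scale (h.rotate hna).swap (m := log (v a) + log (v b)) ?_ ?_
    · rw [Valuation.map_neg, map_mul, exp_add, ← hva, ← hvb]
    · rw [Int.not_even_iff_odd] at h1 h2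
      exact h1.add_odd h2

lemma exists_lt (h : HasConicGen L a b) (hna : ¬ Algebra.IsAlgebraic l L) (hπ : v π = exp (-1))
    (hperf : v 2 < 1 → ∀ u, v u ≤ 1 → ∃ z, v (u - z ^ 2) < 1) (ha : v a = 1)
    (h4 : v 4 < v (1 - a)) : ∃ d c, HasConicGen L d c ∧ v d = 1 ∧ v (1 - d) < v (1 - a) := by
  have hπ0 : π ≠ 0 := by rintro rfl; exact exp_ne_zero (by rw [← hπ, map_zero])
  have he1 : v (1 - a) ≤ 1 := by simpa [ha] using v.map_sub 1 a
  have h22 : v 4 = v 2 ^ 2 := by rw [← map_pow]; norm_num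
  have h2 : v 2 < 1 := by
    by_contra! h2
    have : 1 ≤ v 4 := by rw [h22]; exact one_le_pow₀ h2
    exact absurd (lt_of_lt_of_le h4 he1) (not_lt.2 this)
  have hperf' : ∀ u, v u = 1 → ∃ z, v z ≤ 1 ∧ v (u - z ^ 2) < 1 := by
    intro u hu
    obtain ⟨z, hz⟩ := hperf h2 u hu.le
    refine ⟨z, ?_, hz⟩
    have : v (z ^ 2) ≤ 1 := by
      have e : z ^ 2 = u - (u - z ^ 2) := by ring
      rw [e]
      exact (v.map_sub _ _).trans (max_le hu.le hz.le)
    rw [map_pow] at this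
    exact (pow_le_one_iff two_ne_zero).1 this
  have hunit : ∀ d, v (1 - d) < v (1 - a) → v d = 1 := fun d hd =>
    Valuation.eq_one_of_sub_one_lt (by rw [Valuation.map_sub_swap]; exact hd.trans_le he1)
  have he0 : v (1 - a) ≠ 0 := fun h0 => by simp [h0] at h4
  have he0' : 1 - a ≠ 0 := by simpa using he0
  have ha0 : a ≠ 0 := h.1
  obtain ⟨n, hn⟩ : ∃ n, v (1 - a) = exp n := ⟨_, (exp_log he0).symm⟩
  have hpow : ∀ j : ℤ, v (π ^ (-j)) = exp j := fun j => by
    rw [map_zpow₀, hπ, ← exp_zsmul]; simp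
  rcases Int.even_or_odd n with ⟨j, rfl⟩ | hodd
  · have ht0 : π ^ (-j) ≠ 0 := zpow_ne_zero _ hπ0
    have ht := hpow j
    set t := π ^ (-j) with ht_def
    have hte : v (1 - a) = v t ^ 2 := by rw [hn, ht, sq, exp_add]
    have h2t : v 2 < v t := by
      rw [h22, hte] at h4
      exact lt_of_pow_lt_pow_left₀ 2 zero_le h4
    have hvt0 : 0 < v t := by rw [ht]; exact exp_pos
    obtain ⟨η, hη1, hη⟩ := hperf' ((1 - a) / (a * t ^ 2)) (by
      rw [map_div₀, map_mul, ha, map_pow, one_mul, hte, div_self (pow_ne_zero 2 hvt0.ne')])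
    have hlt : v (1 - a * (1 + t * η) ^ 2) < v (1 - a) := by
      have e : 1 - a * (1 + t * η) ^ 2 =
          (a * t ^ 2) * ((1 - a) / (a * t ^ 2) - η ^ 2) - 2 * t * (a * η) := by
        field_simp; ring
      rw [e]
      refine lt_of_le_of_lt (v.map_sub _ _) (max_lt ?_ ?_)
      · rw [map_mul, map_mul, ha, one_mul, map_pow, ← hte]
        exact mul_lt_of_lt_one_right (zero_lt_iff.2 he0) hη
      · rw [map_mul, map_mul, map_mul, ha, one_mul, hte, sq]
        calc v 2 * v t * v η ≤ v 2 * v t * 1 := by gcongr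
          _ = v 2 * v t := mul_one _
          _ < v t * v t := mul_lt_mul_of_pos_right h2t hvt0
    have hd := hunit _ hlt
    refine ⟨_, _, h.mul_sq (t := 1 + t * η) ?_, hd, hlt⟩
    intro h0
    rw [h0] at hd
    simp at hd
  · obtain ⟨c, k, hc, hk, hvc⟩ : ∃ (c : l) (k : ℤ), HasConicGen L a c ∧ Odd k ∧ v c = exp k := by
      have hvb : v b = exp (log (v b)) := (exp_log (by simpa using h.2.1)).symm
      rcases Int.even_or_odd (log (v b)) with h1 | h1
      · exact ⟨b * (1 - a), log (v b) + n, h.mul_one_sub hna he0', h1.add_odd hodd, by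
          rw [map_mul, hn, exp_add, ← hvb]⟩
      · exact ⟨b, _, h, h1, hvb⟩
    obtain ⟨i, hi⟩ := hodd.sub_odd hk
    have hw0 : π ^ (-i) ≠ 0 := zpow_ne_zero _ hπ0
    have hw := hpow i
    set w := π ^ (-i) with hw_def
    have hcw : v (c * w ^ 2) = v (1 - a) := by
      rw [map_mul, map_pow, hvc, hw, hn, ← exp_nsmul, ← exp_add]
      congr 1
      simp
      omega
    have hc0 : c ≠ 0 := hc.2.1
    obtain ⟨η, hη1, hη⟩ := hperf' ((1 - a) / (c * w ^ 2)) (by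
      rw [map_div₀, hcw, div_self he0])
    have hlt : v (1 - (a + c * (w * η) ^ 2)) < v (1 - a) := by
      have e : 1 - (a + c * (w * η) ^ 2) = (c * w ^ 2) * ((1 - a) / (c * w ^ 2) - η ^ 2) := by
        field_simp; ring
      rw [e, map_mul, hcw]
      exact mul_lt_of_lt_one_right (zero_lt_iff.2 he0) hη
    have hd := hunit _ hlt
    refine ⟨_, _, hc.add_mul_sq (z := w * η) ?_, hd, hlt⟩
    intro h0
    rw [h0] at hd
    simp at hd

/-- Every conic over a discretely valued field with perfect residue field has, in a suitable
form, good reduction of its first coefficient. -/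
lemma exists_good [CharZero l] (h : HasConicGen L a b) (hna : ¬ Algebra.IsAlgebraic l L)
    (hπ : v π = exp (-1)) (hperf : v 2 < 1 → ∀ u, v u ≤ 1 → ∃ z, v (u - z ^ 2) < 1) :
    ∃ q c, HasConicGen L (1 - 4 * q) c ∧ v (1 - 4 * q) = 1 ∧ v q ≤ 1 ∧ v c ≤ 1 := by
  have hπ0 : π ≠ 0 := by rintro rfl; exact exp_ne_zero (by rw [← hπ, map_zero])
  have h40 : v 4 ≠ 0 := by simp
  have key : ∃ d c, HasConicGen L d c ∧ v d = 1 ∧ v (1 - d) ≤ v 4 := by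
    obtain ⟨d, c, hdc, hd⟩ := h.exists_unit hna hπ
    induction hn : (log (v (1 - d)) - log (v 4)).toNat using Nat.strong_induction_on
      generalizing d c with
    | _ n ih =>
    by_cases hle : v (1 - d) ≤ v 4
    · exact ⟨d, c, hdc, hd, hle⟩
    rw [not_le] at hle
    obtain ⟨d', c', hdc', hd', hlt⟩ := hdc.exists_lt hna hπ hperf hd hle
    by_cases hle' : v (1 - d') ≤ v 4
    · exact ⟨d', c', hdc', hd', hle'⟩
    rw [not_le] at hle'
    have h0 : v (1 - d') ≠ 0 := fun h0 => by simp [h0] at hle'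
    have h0' : v (1 - d) ≠ 0 := fun h0 => by simp [h0] at hle
    refine ih _ ?_ d' c' hdc' hd' rfl
    rw [← log_lt_log h0 h0'] at hlt
    rw [← log_lt_log h40 h0] at hle'
    omega
  obtain ⟨d, c, hdc, hd, hle⟩ := key
  have e : 1 - 4 * ((1 - d) / 4) = d := by field_simp; ring
  have hvc : v c = exp (log (v c)) := (exp_log (by simpa using hdc.2.1)).symm
  set j : ℕ := (log (v c)).toNat with hj
  refine ⟨(1 - d) / 4, c * (π ^ j) ^ 2, ?_, ?_, ?_, ?_⟩
  · rw [e]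
    exact (hdc.swap.mul_sq (pow_ne_zero j hπ0)).swap
  · rw [e, hd]
  · rw [map_div₀]
    exact div_le_one_of_le₀ hle zero_le
  · rw [map_mul, map_pow, map_pow, hπ, hvc, ← exp_nsmul, ← exp_nsmul, ← exp_add, ← exp_zero,
      exp_le_exp]
    simp
    omega

end HasConicGen

end Reduction

section GaussExtension

open Polynomial

/-- Every valuation on a field extends to every larger field, as a valuation ring. -/
lemma Valuation.exists_valuationSubring {F E Γ : Type*} [Field F] [Field E]
    [LinearOrderedCommGroupWithZero Γ] (v : Valuation F Γ) (f : F →+* E) :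
    ∃ V : ValuationSubring E, (∀ x, v x ≤ 1 → V.valuation (f x) ≤ 1) ∧
      ∀ x, V.valuation (f x) = 1 → v x = 1 := by
  obtain ⟨V, hV, hloc⟩ :=
    IsLocalRing.exists_factor_valuationRing (f.comp v.valuationSubring.subtype)
  have hle : ∀ x, v x ≤ 1 → V.valuation (f x) ≤ 1 := fun x hx =>
    (V.valuation_le_one_iff _).2 (hV ⟨x, hx⟩)
  have key : ∀ x, v x ≤ 1 → V.valuation (f x) = 1 → v x = 1 := by
    intro x hx h1
    have hu : IsUnit (⟨f x, hV ⟨x, hx⟩⟩ : V) := (V.valuation_eq_one_iff _).2 h1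
    have hu' : IsUnit (⟨x, hx⟩ : v.valuationSubring) := hloc.map_nonunit _ hu
    obtain ⟨⟨y, hy⟩, h⟩ := hu'.exists_right_inv
    have hxy : v x * v y = 1 := by
      rw [← map_mul, ← v.map_one]
      exact congrArg v (congrArg Subtype.val h)
    refine le_antisymm hx ?_
    calc (1 : Γ) = v x * v y := hxy.symm
      _ ≤ v x * 1 := by gcongr; exact hy
      _ = v x := mul_one _
  refine ⟨V, hle, fun x h1 => ?_⟩
  rcases le_total (v x) 1 with hx | hx
  · exact key x hx h1
  · rw [← inv_inj, inv_one, ← map_inv₀]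
    refine key _ ?_ (by rw [map_inv₀, map_inv₀, h1, inv_one])
    rw [map_inv₀]
    exact inv_le_one_of_one_le₀ hx

variable {E : Type*} [Field E] (V : ValuationSubring E)

/-- The valuation ring `A` is the Gauss extension of `V`. -/
def ValuationSubring.IsGauss (A : ValuationSubring (RatFunc E)) : Prop := ∀ p : V[X],
  A.valuation (algebraMap E[X] (RatFunc E) (p.map V.subtype)) ≤ 1 ∧
    (A.valuation (algebraMap E[X] (RatFunc E) (p.map V.subtype)) = 1 ↔
      p.map (IsLocalRing.residue V) ≠ 0)

/-- Every valuation ring has a Gauss extension to the rational function field. -/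
lemma ValuationSubring.exists_isGauss : ∃ A : ValuationSubring (RatFunc E), V.IsGauss A := by
  let P : Ideal V[X] := RingHom.ker (mapRingHom (IsLocalRing.residue V))
  have : P.IsPrime := RingHom.ker_isPrime _
  let f : V[X] →+* RatFunc E := (algebraMap E[X] (RatFunc E)).comp (mapRingHom V.subtype)
  have hf : Function.Injective f := (RatFunc.algebraMap_injective E).comp
    (map_injective _ V.subtype_injective)
  have hunit : ∀ y : P.primeCompl, IsUnit (f y) := by
    rintro ⟨y, hy⟩
    rw [isUnit_iff_ne_zero, Ne, map_eq_zero_iff f hf]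
    rintro rfl
    exact hy P.zero_mem
  let g : Localization.AtPrime P →+* RatFunc E := IsLocalization.lift hunit
  have hg : ∀ p, g (algebraMap _ _ p) = f p := fun p => IsLocalization.lift_eq hunit p
  obtain ⟨A, hA, hloc⟩ := IsLocalRing.exists_factor_valuationRing (R := Localization.AtPrime P) g
  refine ⟨A, fun p => ⟨?_, ?_⟩⟩
  · rw [A.valuation_le_one_iff]
    have := hA (algebraMap _ _ p)
    rwa [hg] at this
  · have h1 : A.valuation (f p) = 1 ↔ IsUnit (g.codRestrict A.toSubring hA (algebraMap _ _ p)) := by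
      rw [← hg]
      exact (A.valuation_eq_one_iff (g.codRestrict A.toSubring hA (algebraMap _ _ p))).symm
    refine h1.trans ?_
    rw [isUnit_map_iff, IsLocalization.AtPrime.isUnit_to_map_iff _ P]
    exact Iff.rfl

variable {V} in
lemma ValuationSubring.exists_eq_C_mul {p : E[X]} (hp : p ≠ 0) : ∃ c : E, c ≠ 0 ∧ ∃ q : V[X],
    p = Polynomial.C c * q.map V.subtype ∧ q.map (IsLocalRing.residue V) ≠ 0 := by
  obtain ⟨i, hi, hmax⟩ := Finset.exists_max_image p.support (fun n => V.valuation (p.coeff n))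
    (Polynomial.support_nonempty.2 hp)
  have hc : p.coeff i ≠ 0 := Polynomial.mem_support_iff.1 hi
  have hmax' : ∀ n, V.valuation (p.coeff n) ≤ V.valuation (p.coeff i) := by
    intro n
    by_cases hn : p.coeff n = 0
    · rw [hn, map_zero]; exact zero_le
    · exact hmax n (Polynomial.mem_support_iff.2 hn)
  have hl : Polynomial.C (p.coeff i)⁻¹ * p ∈ Polynomial.lifts V.subtype := by
    rw [Polynomial.lifts_iff_coeff_lifts]
    intro n
    refine ⟨⟨(p.coeff i)⁻¹ * p.coeff n, ?_⟩, by simp⟩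
    rw [← V.valuation_le_one_iff, map_mul, map_inv₀, mul_comm, ← div_eq_mul_inv]
    exact div_le_one_of_le₀ (hmax' n) zero_le
  obtain ⟨q, hq⟩ := (Polynomial.mem_lifts _).1 hl
  refine ⟨_, hc, q, ?_, ?_⟩
  · rw [hq, ← mul_assoc, ← Polynomial.C_mul, mul_inv_cancel₀ hc, Polynomial.C_1, one_mul]
  · intro h0
    have h1 : V.subtype (q.coeff i) = 1 := by
      rw [← Polynomial.coeff_map, hq, Polynomial.coeff_C_mul, inv_mul_cancel₀ hc]
    have h2 : q.coeff i = 1 := V.subtype_injective (by rw [h1, map_one])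
    have h3 := congrArg (Polynomial.coeff · i) h0
    simp [h2] at h3

variable {V} in
lemma ValuationSubring.exists_eq_C_mul_div {F : RatFunc E} (hF : F ≠ 0) : ∃ c : E, c ≠ 0 ∧ ∃ p q : V[X],
    p.map (IsLocalRing.residue V) ≠ 0 ∧ q.map (IsLocalRing.residue V) ≠ 0 ∧
    F = RatFunc.C c * (algebraMap E[X] (RatFunc E) (p.map V.subtype) /
      algebraMap E[X] (RatFunc E) (q.map V.subtype)) := by
  obtain ⟨c, hc, p, hp, hp'⟩ := exists_eq_C_mul (V := V) (RatFunc.num_ne_zero hF)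
  obtain ⟨d, hd, q, hq, hq'⟩ := exists_eq_C_mul (V := V) F.denom_ne_zero
  refine ⟨c / d, div_ne_zero hc hd, p, q, hp', hq', ?_⟩
  conv_lhs => rw [← RatFunc.num_div_denom F, hp, hq, map_mul, map_mul, RatFunc.algebraMap_C,
    RatFunc.algebraMap_C, mul_div_mul_comm, ← map_div₀]

namespace ValuationSubring.IsGauss

variable {V} {A : ValuationSubring (RatFunc E)} (hA : V.IsGauss A)
include hA

lemma valuation_C_eq_one_iff {e : E} : A.valuation (RatFunc.C e) = 1 ↔ V.valuation e = 1 := by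
  have key : ∀ e, V.valuation e ≤ 1 → (A.valuation (RatFunc.C e) = 1 ↔ V.valuation e = 1) := by
    intro e he
    have h := (hA (Polynomial.C ⟨e, (V.valuation_le_one_iff e).1 he⟩)).2
    rw [Polynomial.map_C, Polynomial.map_C, Polynomial.C_ne_zero, IsLocalRing.residue_ne_zero_iff_isUnit,
      ValuationSubring.valuation_eq_one_iff] at h
    simpa using h
  rcases le_total (V.valuation e) 1 with he | he
  · exact key e he
  · rw [← inv_inj, inv_one, ← map_inv₀, ← map_inv₀, key, map_inv₀, inv_eq_one]
    rw [map_inv₀]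
    exact inv_le_one_of_one_le₀ he

lemma C_notMem_unitSq {c : E} (h : ∀ z, V.valuation (c * z ^ 2) ≠ 1) :
    RatFunc.C c ∉ A.valuation.unitSq := by
  rintro ⟨F, hF⟩
  have hF0 : F ≠ 0 := by rintro rfl; simp at hF
  obtain ⟨d, hd, p, q, hp, hq, rfl⟩ := exists_eq_C_mul_div (V := V) hF0
  refine h d ?_
  rw [← hA.valuation_C_eq_one_iff, map_mul, map_pow, map_mul, map_pow]
  rw [map_mul, map_pow, map_mul, map_div₀, (hA p).2.2 hp, (hA q).2.2 hq, div_one, mul_one] at hF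
  exact hF

lemma exists_of_mem_principalSq {G : RatFunc E} (hG : G ∈ A.valuation.principalSq) {p : V[X]}
    (hp : p.map (IsLocalRing.residue V) ≠ 0) (k : ℕ)
    (h : G * RatFunc.X ^ k = algebraMap E[X] (RatFunc E) (p.map V.subtype)) :
    ∃ (ε : IsLocalRing.ResidueField V) (f g : (IsLocalRing.ResidueField V)[X]), ε ≠ 0 ∧ f ≠ 0 ∧
      Polynomial.C ε * p.map (IsLocalRing.residue V) * f ^ 2 = Polynomial.X ^ k * g ^ 2 := by
  obtain ⟨ε, F, hε, hF⟩ := hG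
  have hX : A.valuation (RatFunc.X : RatFunc E) = 1 := by
    simpa using (hA Polynomial.X).2.2
  have hF0 : F ≠ 0 := by rintro rfl; simp at hF
  obtain ⟨c, hc, f, g, hf, hg, rfl⟩ := exists_eq_C_mul_div (V := V) hF0
  have hvg := (hA g).2.2 hg
  have hvf := (hA f).2.2 hf
  have hg0 : algebraMap E[X] (RatFunc E) (g.map V.subtype) ≠ 0 := by
    intro h0
    rw [h0, map_zero] at hvg
    exact zero_ne_one hvg
  have hvG : A.valuation G = 1 := by
    have := congrArg A.valuation h
    rwa [map_mul, map_pow, hX, one_pow, mul_one, (hA p).2.2 hp] at this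
  obtain ⟨e, he, rfl⟩ : ∃ e : V, (e : E) ^ 2 = 1 ∧ RatFunc.C (e : E) = ε := by
    rcases (show ε = 1 ∨ ε = -1 by rwa [← sq_eq_sq_iff_eq_or_eq_neg, one_pow]) with rfl | rfl
    · exact ⟨1, by simp, by simp⟩
    · exact ⟨-1, by simp, by simp⟩
  have hvc : V.valuation c = 1 := by
    have := Valuation.eq_one_of_sub_one_lt hF
    rw [map_mul, map_mul, hvG, Valuation.map_eq_one_of_sq_eq_one hε, map_pow, map_mul, map_div₀,
      hvf, hvg, div_one, mul_one, mul_one, one_mul, pow_eq_one_iff] at this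
    exact hA.valuation_C_eq_one_iff.1 (this.resolve_right two_ne_zero)
  obtain ⟨c, rfl⟩ : ∃ c' : V, (c' : E) = c := ⟨⟨c, (V.valuation_le_one_iff c).1 hvc.le⟩, rfl⟩
  have hlt : A.valuation (algebraMap E[X] (RatFunc E) ((Polynomial.C e * p * (Polynomial.C c * f) ^ 2
      - Polynomial.X ^ k * g ^ 2).map V.subtype)) < 1 := by
    have e1 : algebraMap E[X] (RatFunc E) ((Polynomial.C e * p * (Polynomial.C c * f) ^ 2
      - Polynomial.X ^ k * g ^ 2).map V.subtype) =
      (RatFunc.C (e : E) * G * (RatFunc.C (c : E) *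
        (algebraMap E[X] (RatFunc E) (f.map V.subtype) /
          algebraMap E[X] (RatFunc E) (g.map V.subtype))) ^ 2 - 1) *
        (RatFunc.X ^ k * algebraMap E[X] (RatFunc E) (g.map V.subtype) ^ 2) := by
      simp only [Polynomial.map_sub, Polynomial.map_mul, Polynomial.map_pow, Polynomial.map_C,
        Polynomial.map_X, map_sub, map_mul, map_pow, RatFunc.algebraMap_C, RatFunc.algebraMap_X,
        ← h, ValuationSubring.subtype_apply]
      field_simp
    rw [e1, map_mul, map_mul, map_pow, map_pow, hX, hvg, one_pow, one_pow, mul_one, mul_one]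
    exact hF
  have h0 := (hA _).2.not.1 hlt.ne
  rw [not_not] at h0
  refine ⟨IsLocalRing.residue V e, Polynomial.C (IsLocalRing.residue V c) *
    f.map (IsLocalRing.residue V), g.map (IsLocalRing.residue V), ?_, ?_, ?_⟩
  · intro h1
    have : IsLocalRing.residue V (e ^ 2) = 0 := by rw [map_pow, h1]; simp
    rw [show e ^ 2 = 1 from Subtype.ext he, map_one] at this
    exact one_ne_zero this
  · refine mul_ne_zero ?_ hf
    rw [Polynomial.C_ne_zero, IsLocalRing.residue_ne_zero_iff_isUnit,
      ValuationSubring.valuation_eq_one_iff]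
    exact hvc
  · simpa [sub_eq_zero] using h0

end ValuationSubring.IsGauss

section ResiduePolynomials

variable {κ : Type*} [Field κ] {ε b : κ} {f g p : κ[X]}

lemma Polynomial.C_mul_mul_sq_ne_X_mul_sq (hε : ε ≠ 0) (hf : f ≠ 0) (hp : p.natDegree = 2) :
    Polynomial.C ε * p * f ^ 2 ≠ Polynomial.X ^ 1 * g ^ 2 := by
  intro h
  have hp0 : p ≠ 0 := by rintro rfl; simp at hp
  have hg : g ≠ 0 := by
    rintro rfl
    have : Polynomial.C ε * p * f ^ 2 ≠ 0 :=
      mul_ne_zero (mul_ne_zero (Polynomial.C_ne_zero.2 hε) hp0) (pow_ne_zero 2 hf)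
    simp [this] at h
  have := congrArg Polynomial.natDegree h
  rw [pow_one, Polynomial.natDegree_X_mul (pow_ne_zero 2 hg), mul_assoc,
    Polynomial.natDegree_C_mul hε, Polynomial.natDegree_mul hp0 (pow_ne_zero 2 hf), hp,
    Polynomial.natDegree_pow, Polynomial.natDegree_pow] at this
  omega

lemma Polynomial.natDegree_X_sq_add_C : (Polynomial.X ^ 2 + Polynomial.C b).natDegree = 2 := by
  compute_degree!

lemma Polynomial.natDegree_X_sq_add_X_add_C :
    (Polynomial.X ^ 2 + Polynomial.X + Polynomial.C b).natDegree = 2 := by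
  compute_degree!

lemma Polynomial.C_mul_mul_sq_ne_X_sq_mul_sq (hε : ε ≠ 0) (hf : f ≠ 0) :
    Polynomial.C ε * ((Polynomial.X ^ 2 + Polynomial.C b) *
      (Polynomial.X ^ 2 + Polynomial.X + Polynomial.C b)) * f ^ 2 ≠ Polynomial.X ^ 2 * g ^ 2 := by
  intro h
  have hdvd : f ∣ Polynomial.X * g := by
    rw [← IsIntegrallyClosed.pow_dvd_pow_iff two_ne_zero, mul_pow, ← h]
    exact Dvd.intro_left _ rfl
  obtain ⟨r, hr⟩ := hdvd
  have hr2 : Polynomial.C ε * ((Polynomial.X ^ 2 + Polynomial.C b) *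
      (Polynomial.X ^ 2 + Polynomial.X + Polynomial.C b)) = r ^ 2 := by
    refine mul_right_cancel₀ (pow_ne_zero 2 hf) ?_
    rw [h, ← mul_pow, hr, mul_pow, mul_comm]
  have hdeg : r.natDegree = 2 := by
    have := congrArg Polynomial.natDegree hr2
    rw [Polynomial.natDegree_C_mul hε, Polynomial.natDegree_pow,
      Polynomial.natDegree_mul, natDegree_X_sq_add_C, natDegree_X_sq_add_X_add_C] at this
    · omega
    · intro h0; simpa [h0] using natDegree_X_sq_add_C (b := b)
    · intro h0; simpa [h0] using natDegree_X_sq_add_X_add_C (b := b)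
  obtain ⟨u, v, w, rfl⟩ : ∃ u v w, r = Polynomial.C u * Polynomial.X ^ 2 +
      Polynomial.C v * Polynomial.X + Polynomial.C w :=
    ⟨_, _, _, Polynomial.eq_quadratic_of_degree_le_two
      (Polynomial.degree_le_of_natDegree_le hdeg.le)⟩
  have e : Polynomial.C (ε - u ^ 2) * Polynomial.X ^ 4 +
      Polynomial.C (ε - 2 * u * v) * Polynomial.X ^ 3 +
      Polynomial.C (2 * b * ε - v ^ 2 - 2 * u * w) * Polynomial.X ^ 2 +
      Polynomial.C (b * ε - 2 * v * w) * Polynomial.X ^ 1 +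
      Polynomial.C (b ^ 2 * ε - w ^ 2) = 0 := by
    simp only [map_sub, map_mul, map_pow, map_ofNat]
    linear_combination hr2
  have e4 := congrArg (Polynomial.coeff · 4) e
  have e3 := congrArg (Polynomial.coeff · 3) e
  have e2 := congrArg (Polynomial.coeff · 2) e
  have e1 := congrArg (Polynomial.coeff · 1) e
  simp only [Polynomial.coeff_add, Polynomial.coeff_C_mul, Polynomial.coeff_X_pow,
    Polynomial.coeff_C, Polynomial.coeff_zero] at e4 e3 e2 e1
  norm_num at e4 e3 e2 e1
  have hw : w = b * u := by
    refine mul_left_cancel₀ hε ?_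
    linear_combination w * e3 - u * e1
  have hv : v = 0 := by
    rw [← sq_eq_zero_iff, ← sub_eq_zero]
    rw [hw] at e2
    linear_combination -e2 + 2 * b * e4
  rw [hv] at e3
  simp at e3
  exact hε e3

end ResiduePolynomials

namespace ValuationSubring.IsGauss

variable {V} {A : ValuationSubring (RatFunc E)} (hA : V.IsGauss A)
include hA

lemma isDetected {L : Type*} [Field L] (φ : L →+* RatFunc E) {f h : L} {b : E}
    (hb : V.valuation b ≤ 1) (hh : φ h = RatFunc.X + RatFunc.C b / RatFunc.X)
    (hf : φ f ∉ A.valuation.unitSq) : IsDetected f := by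
  obtain ⟨b, rfl⟩ : ∃ b' : V, (b' : E) = b := ⟨⟨b, (V.valuation_le_one_iff b).1 hb⟩, rfl⟩
  have hX0 : (RatFunc.X : RatFunc E) ≠ 0 := RatFunc.X_ne_zero
  have hX : A.valuation (RatFunc.X : RatFunc E) = 1 := by
    simpa using (hA Polynomial.X).2.2
  let p₁ : V[X] := Polynomial.X ^ 2 + Polynomial.C b
  let p₂ : V[X] := Polynomial.X ^ 2 + Polynomial.X + Polynomial.C b
  have m₁ : p₁.map (IsLocalRing.residue V) =
      Polynomial.X ^ 2 + Polynomial.C (IsLocalRing.residue V b) := by simp [p₁]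
  have m₂ : p₂.map (IsLocalRing.residue V) =
      Polynomial.X ^ 2 + Polynomial.X + Polynomial.C (IsLocalRing.residue V b) := by simp [p₂]
  have d₁ : (p₁.map (IsLocalRing.residue V)).natDegree = 2 := by
    rw [m₁, Polynomial.natDegree_X_sq_add_C]
  have d₂ : (p₂.map (IsLocalRing.residue V)).natDegree = 2 := by
    rw [m₂, Polynomial.natDegree_X_sq_add_X_add_C]
  have n₁ : p₁.map (IsLocalRing.residue V) ≠ 0 := fun h0 => by simp [h0] at d₁
  have n₂ : p₂.map (IsLocalRing.residue V) ≠ 0 := fun h0 => by simp [h0] at d₂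
  have f₁ : φ h * RatFunc.X ^ 1 = algebraMap E[X] (RatFunc E) (p₁.map V.subtype) := by
    simp [p₁, hh]
    field_simp
  have f₂ : (1 + φ h) * RatFunc.X ^ 1 = algebraMap E[X] (RatFunc E) (p₂.map V.subtype) := by
    simp [p₂, hh]
    field_simp
    ring
  have f₃ : φ h * (1 + φ h) * RatFunc.X ^ 2 =
      algebraMap E[X] (RatFunc E) ((p₁ * p₂).map V.subtype) := by
    rw [Polynomial.map_mul, map_mul, ← f₁, ← f₂]
    ring
  refine A.valuation.isDetected φ (h := h) hf ?_ ?_ ?_ ?_ ?_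
  · have := congrArg A.valuation f₁
    rwa [map_mul, map_pow, hX, one_pow, mul_one, (hA p₁).2.2 n₁] at this
  · have := congrArg A.valuation f₂
    rwa [map_mul, map_pow, hX, one_pow, mul_one, (hA p₂).2.2 n₂] at this
  · intro hm
    obtain ⟨ε, f, g, hε, hf, e⟩ := hA.exists_of_mem_principalSq hm n₁ 1 f₁
    exact Polynomial.C_mul_mul_sq_ne_X_mul_sq hε hf d₁ e
  · intro hm
    obtain ⟨ε, f, g, hε, hf, e⟩ := hA.exists_of_mem_principalSq hm n₂ 1 f₂
    exact Polynomial.C_mul_mul_sq_ne_X_mul_sq hε hf d₂ e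
  · intro hm
    obtain ⟨ε, f, g, hε, hf, e⟩ := hA.exists_of_mem_principalSq hm
      (by rw [Polynomial.map_mul]; exact mul_ne_zero n₁ n₂) 2 f₃
    rw [Polynomial.map_mul, m₁, m₂] at e
    exact Polynomial.C_mul_mul_sq_ne_X_sq_mul_sq hε hf e

end ValuationSubring.IsGauss

end GaussExtension

section OddConstants

open WithZero IsDedekindDomain NumberField

/-- Unramified quadratic extensions do not enlarge the value group. -/
lemma ValuationSubring.exists_valuation_eq {F E Γ : Type*} [Field F] [CharZero F] [Field E]
    [Algebra F E] [LinearOrderedCommGroupWithZero Γ] (v : Valuation F Γ) (V : ValuationSubring E)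
    (hV : ∀ x, v x ≤ 1 → V.valuation (algebraMap F E x) ≤ 1) {q : F} {s : E}
    (hs : s ^ 2 = algebraMap F E (1 - 4 * q)) (hq : v q ≤ 1) (hs1 : V.valuation s = 1)
    (hgen : ∀ e : E, ∃ c₀ c₁ : F, e = algebraMap F E c₀ + algebraMap F E c₁ * s) {e : E} :
    ∃ c : F, V.valuation e = V.valuation (algebraMap F E c) := by
  have : CharZero E := charZero_of_injective_algebraMap (algebraMap F E).injective
  set w : E := (1 + s) / 2 with hw
  have hs2 : s = 2 * w - 1 := by rw [hw]; field_simp; ring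
  have hww : w ^ 2 = w - algebraMap F E q := by
    rw [map_sub, map_mul, map_one, map_ofNat, hs2] at hs
    have h4 : (4 : E) ≠ 0 := by norm_num
    refine mul_left_cancel₀ h4 ?_
    linear_combination hs
  have hw1 : V.valuation w ≤ 1 := by
    by_contra! h1
    have h2 : V.valuation w ^ 2 ≤ V.valuation w := by
      rw [← map_pow, hww]
      exact (V.valuation.map_sub _ _).trans (max_le le_rfl ((hV q hq).trans h1.le))
    rw [sq] at h2
    have h0 : 0 < V.valuation w := zero_lt_one.trans h1
    exact absurd (le_of_mul_le_mul_right (h2.trans_eq (one_mul _).symm) h0) (not_le.2 h1)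
  have key : ∀ c d : F, v c ≤ 1 → v d ≤ 1 → v c = 1 ∨ v d = 1 →
      ∃ r : F, V.valuation (algebraMap F E c + algebraMap F E d * w) =
        V.valuation (algebraMap F E r) := by
    intro c d hc hd hcd
    have hV1 : ∀ x, v x = 1 → V.valuation (algebraMap F E x) = 1 := by
      intro x hx
      refine le_antisymm (hV x hx.le) ?_
      have := hV x⁻¹ (by rw [map_inv₀, hx, inv_one])
      rw [map_inv₀, map_inv₀] at this
      have hx0 : V.valuation (algebraMap F E x) ≠ 0 := by
        intro h0
        have : x = 0 := by simpa using h0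
        simp [this] at hx
      exact (inv_le_one₀ (zero_lt_iff.2 hx0)).1 this
    have hle : V.valuation (algebraMap F E c + algebraMap F E d * w) ≤ 1 := by
      refine (V.valuation.map_add _ _).trans (max_le (hV c hc) ?_)
      rw [map_mul]
      exact mul_le_one' (hV d hd) hw1
    rcases hle.lt_or_eq with hlt | heq
    swap
    · exact ⟨1, by rw [heq, map_one, map_one]⟩
    have hw' : V.valuation (1 - w) ≤ 1 := (V.valuation.map_sub _ _).trans (by simp [hw1])
    have hN : (algebraMap F E c + algebraMap F E d * w) *
        (algebraMap F E c + algebraMap F E d * (1 - w)) =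
        algebraMap F E (c ^ 2 + c * d + q * d ^ 2) := by
      simp only [map_add, map_mul, map_pow]
      linear_combination -(algebraMap F E d) ^ 2 * hww
    refine ⟨c ^ 2 + c * d + q * d ^ 2, ?_⟩
    have hconj : V.valuation (algebraMap F E c + algebraMap F E d * (1 - w)) = 1 := by
      have hle' : V.valuation (algebraMap F E c + algebraMap F E d * (1 - w)) ≤ 1 := by
        refine (V.valuation.map_add _ _).trans (max_le (hV c hc) ?_)
        rw [map_mul]
        exact mul_le_one' (hV d hd) hw'
      by_contra h1
      have hlt' := lt_of_le_of_ne hle' h1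
      have hd1 : V.valuation (algebraMap F E d) < 1 := by
        have e : algebraMap F E d * s = (algebraMap F E c + algebraMap F E d * w) -
            (algebraMap F E c + algebraMap F E d * (1 - w)) := by rw [hs2]; ring
        have := congrArg V.valuation e
        rw [map_mul, hs1, mul_one] at this
        rw [this]
        exact (V.valuation.map_sub _ _).trans_lt (max_lt hlt hlt')
      have hc1 : V.valuation (algebraMap F E c) < 1 := by
        have e : algebraMap F E c = (algebraMap F E c + algebraMap F E d * w) -
          algebraMap F E d * w := by ring
        rw [e]
        refine (V.valuation.map_sub _ _).trans_lt (max_lt hlt ?_)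
        rw [map_mul]
        exact (mul_le_of_le_one_right' hw1).trans_lt hd1
      rcases hcd with h | h
      · exact hc1.ne (hV1 c h)
      · exact hd1.ne (hV1 d h)
    rw [← hN, map_mul, hconj, mul_one]
  obtain ⟨c₀, c₁, he⟩ := hgen e
  obtain ⟨c, d, he⟩ : ∃ c d : F, e = algebraMap F E c + algebraMap F E d * w :=
    ⟨c₀ - c₁, 2 * c₁, by
      rw [he, hs2, map_sub, map_mul, map_ofNat]
      ring⟩
  have scale : ∀ t : F, t ≠ 0 → v c ≤ v t → v d ≤ v t → v c = v t ∨ v d = v t →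
      ∃ c : F, V.valuation e = V.valuation (algebraMap F E c) := by
    intro t ht hc hd hcd
    have hvt : v t ≠ 0 := (Valuation.ne_zero_iff _).2 ht
    obtain ⟨r, hr⟩ := key (c / t) (d / t)
      (by rw [map_div₀]; exact div_le_one_of_le₀ hc zero_le)
      (by rw [map_div₀]; exact div_le_one_of_le₀ hd zero_le)
      (by rw [map_div₀, map_div₀, div_eq_one_iff_eq hvt, div_eq_one_iff_eq hvt]; exact hcd)
    refine ⟨t * r, ?_⟩
    have ht' : algebraMap F E t ≠ 0 := (map_ne_zero _).2 ht
    rw [map_mul, map_mul, ← hr, ← map_mul, he, map_div₀, map_div₀]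
    congr 1
    field_simp
  rcases le_total (v c) (v d) with h | h
  · by_cases hd : d = 0
    · exact ⟨c, by rw [he, hd]; simp⟩
    · exact scale d hd h le_rfl (.inr rfl)
  · by_cases hc : c = 0
    · rw [hc, map_zero, le_zero_iff, Valuation.zero_iff] at h
      exact ⟨0, by rw [he, hc, h]; simp⟩
    · exact scale c hc le_rfl h (.inl rfl)

/-- Modulo a prime above two, every integral element of a number field is a square. -/
lemma IsDedekindDomain.HeightOneSpectrum.exists_valuation_sub_sq_lt_one {l : Type*} [Field l]
    [NumberField l] (p : HeightOneSpectrum (𝓞 l)) (h2 : p.valuation l 2 < 1) (u : l)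
    (hu : p.valuation l u ≤ 1) : ∃ z, p.valuation l (u - z ^ 2) < 1 := by
  obtain ⟨r, hr⟩ := p.exists_valuation_sub_lt_of_integer hu 1
  have h2' : (2 : 𝓞 l) ∈ p.asIdeal := by
    rw [← p.valuation_lt_one_iff_mem (K := l)]
    exact h2
  have : Finite (𝓞 l ⧸ p.asIdeal) := Ideal.finiteQuotientOfFreeOfNeBot _ p.ne_bot
  have : CharP (𝓞 l ⧸ p.asIdeal) 2 := CharTwo.of_one_ne_zero_of_two_eq_zero one_ne_zero (by
    rw [← map_ofNat (Ideal.Quotient.mk p.asIdeal) 2]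
    exact Ideal.Quotient.eq_zero_iff_mem.2 h2')
  obtain ⟨y, hy⟩ := isSquare_of_charTwo' (Ideal.Quotient.mk p.asIdeal r)
  obtain ⟨z, rfl⟩ := Ideal.Quotient.mk_surjective y
  refine ⟨algebraMap (𝓞 l) l z, ?_⟩
  have hz : p.valuation l (algebraMap (𝓞 l) l (r - z ^ 2)) < 1 := by
    rw [p.valuation_lt_one_iff_mem, ← Ideal.Quotient.eq_zero_iff_mem, map_sub, map_pow, hy]
    ring
  have e : u - algebraMap (𝓞 l) l z ^ 2 =
      algebraMap (𝓞 l) l (r - z ^ 2) - (algebraMap (𝓞 l) l r - u) := by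
    rw [map_sub, map_pow]; ring
  rw [e]
  exact (Valuation.map_sub _ _ _).trans_lt (max_lt hz (by simpa using hr))

/-- Constants of odd valuation at some prime are detected. -/
lemma HasConicGen.isDetected {l L : Type*} [Field l] [NumberField l] [Field L] [Algebra l L]
    {a b : l} (h : HasConicGen L a b) (hna : ¬ Algebra.IsAlgebraic l L)
    (p : HeightOneSpectrum (𝓞 l)) {c : l} {m : ℤ} (hm : Odd m) (hc : p.valuation l c = exp m) {g : L} :
    IsDetected (algebraMap l L c * g ^ 2) := by
  obtain ⟨π, hπ⟩ := p.valuation_exists_uniformizer l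
  obtain ⟨q, b, ⟨ha0, hb0, x, y, h⟩, hv, hq, hb⟩ :=
    h.exists_good hna hπ p.exists_valuation_sub_sq_lt_one
  obtain ⟨E, s, φ, hs, hgen, hφ, -, hφy, -⟩ := h.exists_embedding ha0 hb0 hna
  obtain ⟨V, hV, hV1⟩ := (p.valuation l).exists_valuationSubring (algebraMap l E)
  obtain ⟨A, hA⟩ := V.exists_isGauss
  have hs1 : V.valuation s = 1 := by
    have h1 : V.valuation (algebraMap l E (1 - 4 * q)) = 1 := by
      refine le_antisymm (hV _ hv.le) ?_
      have := hV (1 - 4 * q)⁻¹ (by rw [map_inv₀, hv, inv_one])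
      rw [map_inv₀, map_inv₀] at this
      refine (inv_le_one₀ (zero_lt_iff.2 ?_)).1 this
      rw [Valuation.ne_zero_iff]
      exact (map_ne_zero _).2 ha0
    rw [← hs, map_pow, pow_eq_one_iff] at h1
    exact h1.resolve_right two_ne_zero
  refine hA.isDetected φ (hV b hb) hφy ?_
  have hC : RatFunc.C (algebraMap l E c) ∉ A.valuation.unitSq := by
    refine hA.C_notMem_unitSq fun z hz => ?_
    obtain ⟨r, hr⟩ := V.exists_valuation_eq (p.valuation l) hV hs hq hs1 hgen (e := z)
    refine (p.valuation l).notMem_unitSq_of_odd hc hm ⟨r, hV1 _ ?_⟩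
    rw [map_mul, map_mul, map_pow, map_pow, ← hr, ← map_pow, ← map_mul, hz]
  rintro ⟨F, hF⟩
  refine hC ⟨φ g * F, ?_⟩
  rw [← hF, φ.map_mul, φ.map_pow, hφ, mul_pow, mul_assoc]

end OddConstants

section Main

open scoped nonZeroDivisors
open NumberField

/-- A function on a conic either is a square up to a constant generating the square of a
fractional ideal, or is detected by a rigid pair. -/
lemma IsConicFunctionField.eq_mul_sq_or_isDetected {l L : Type*} [Field l] [NumberField l]
    [Field L] {ι : l →+* L} {a b : l} (ha : a ≠ 0) (hb : b ≠ 0)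
    (hL : IsConicFunctionField l a b L ι) {f : L} (hf : f ≠ 0) :
    (∃ (c : l) (g : L), c ≠ 0 ∧ f = ι c * g ^ 2 ∧ ∃ J : FractionalIdeal (𝓞 l)⁰ l,
      FractionalIdeal.spanSingleton (𝓞 l)⁰ c = J ^ 2) ∨ IsDetected f := by
  let : Algebra l L := ι.toAlgebra
  obtain ⟨x, y, h⟩ := IsConicFunctionField.exists_isConicGen (L := L) hL
  have hna := IsConicFunctionField.not_isAlgebraic (L := L) hb hL
  rcases h.eq_algebraMap_mul_sq_or_isDetected ha hb hna hf with ⟨c, g, hc, rfl⟩ | h'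
  · by_cases hJ : ∃ J : FractionalIdeal (𝓞 l)⁰ l, FractionalIdeal.spanSingleton (𝓞 l)⁰ c = J ^ 2
    · exact .inl ⟨c, g, hc, rfl, hJ⟩
    · obtain ⟨p, m, hm, hpc⟩ := FractionalIdeal.exists_odd_valuation hc hJ
      exact .inr (HasConicGen.isDetected ⟨ha, hb, x, y, h⟩ hna p hm hpc)
  · exact .inr h'

lemma IsWittEquiv.symm {K L : Type*} [Field K] [Field L] {α : SqClass K ≃* SqClass L}
    (hα : IsWittEquiv α) : IsWittEquiv α.symm where
  map_neg_one := by rw [← hα.map_neg_one, MulEquiv.symm_apply_apply]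
  represents a b c a' b' c' h₁ h₂ h₃ := by
    rw [MulEquiv.symm_apply_eq] at h₁ h₂ h₃
    exact (hα.represents a' b' c' a b c h₁.symm h₂.symm h₃.symm).symm

lemma IsWittEquiv.exists_map_sqCl_eq {k l K L : Type*} [Field k] [NumberField k] [Field l]
    [NumberField l] [Field K] [Field L] {α : SqClass K ≃* SqClass L} (hα : IsWittEquiv α)
    (ι : k →+* K) {r : kˣ} {I : FractionalIdeal (𝓞 k)⁰ k}
    (hI : FractionalIdeal.spanSingleton (𝓞 k)⁰ (r : k) = I ^ 2)
    {ι' : l →+* L} {a b : l} (ha : a ≠ 0) (hb : b ≠ 0) (hL : IsConicFunctionField l a b L ι') :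
    ∃ s ∈ {s : lˣ | ∃ J : FractionalIdeal (𝓞 l)⁰ l,
      FractionalIdeal.spanSingleton (𝓞 l)⁰ (s : l) = J ^ 2},
      α (sqCl (Units.map ι.toMonoidHom r)) = sqCl (Units.map ι'.toMonoidHom s) := by
  obtain ⟨w, hw⟩ := exists_sqCl_eq (α (sqCl (Units.map ι.toMonoidHom r)))
  rcases hL.eq_mul_sq_or_isDetected ha hb w.ne_zero with
    ⟨c, g, hc, hwc, hJ⟩ | ⟨T, H, h, hP, hsq, hg, ht, hwH⟩
  · have hg : g ≠ 0 := by
      rintro rfl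
      exact w.ne_zero (by rw [hwc]; simp)
    refine ⟨Units.mk0 c hc, hJ, hw.trans (sqCl_eq_iff.2 ⟨Units.mk0 g hg, ?_⟩).symm⟩
    exact Units.ext hwc
  · exact absurd (hP.mem_of_isWittEquiv hsq hg ht hα ι hI hw) hwH

end Main

open scoped nonZeroDivisors in
/-- Let `k, ℓ` be number fields, `K = k_{a,b}`, `L = ℓ_{c,d}`, and `α` a Witt equivalence
from `K` to `L`.  Let `V_k` consist of those `r ∈ kˣ` whose principal fractional ideal is
a square of a fractional ideal, and similarly `V_ℓ`.  Then `α` maps (square classes of)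
elements of `V_k` onto (square classes of) elements of `V_ℓ`. -/
theorem wittEquiv_conic_maps_Vk_to_Vl
    (k : Type*) [Field k] [NumberField k] (l : Type*) [Field l] [NumberField l]
    (a b : k) (ha : a ≠ 0) (hb : b ≠ 0) (c d : l) (hc : c ≠ 0) (hd : d ≠ 0)
    (K : Type*) [Field K] (ι : k →+* K) (hK : IsConicFunctionField k a b K ι)
    (L : Type*) [Field L] (ι' : l →+* L) (hL : IsConicFunctionField l c d L ι')
    (α : SqClass K ≃* SqClass L) (hα : IsWittEquiv α)
    (Vk : Set kˣ)
    (hVk : Vk = {r : kˣ | ∃ I : FractionalIdeal (NumberField.RingOfIntegers k)⁰ k,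
      FractionalIdeal.spanSingleton (NumberField.RingOfIntegers k)⁰ (r : k) = I ^ 2})
    (Vl : Set lˣ)
    (hVl : Vl = {s : lˣ | ∃ J : FractionalIdeal (NumberField.RingOfIntegers l)⁰ l,
      FractionalIdeal.spanSingleton (NumberField.RingOfIntegers l)⁰ (s : l) = J ^ 2}) :
    (∀ r ∈ Vk, ∃ s ∈ Vl,
        α (sqCl (Units.map ι.toMonoidHom r)) = sqCl (Units.map ι'.toMonoidHom s)) ∧
      (∀ s ∈ Vl, ∃ r ∈ Vk,
        α (sqCl (Units.map ι.toMonoidHom r)) = sqCl (Units.map ι'.toMonoidHom s)) := by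
  subst hVk hVl
  have hα' := hα.symm
  exact ⟨fun r ⟨I, hI⟩ => hα.exists_map_sqCl_eq ι hI hc hd hL,
    fun s ⟨J, hJ⟩ => by
      obtain ⟨r, hr, h⟩ := hα'.exists_map_sqCl_eq ι' hJ ha hb hK
      exact ⟨r, hr, by rw [← h, MulEquiv.apply_symm_apply]⟩⟩

end
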